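/- Fix d ≥ 1 and τ ∈ [0,1]. Let A : ℝ^d → ℝ^{d×d} take values in real symmetric matrices, b : ℝ^d → ℝ^d, c : ℝ^d → ℝ, all continuous and bounded together with all their partial derivatives up to order 4, and assume a₀|p|² ≤ p·A(q)p ≤ A₀|p|² for all q, p and some 0 < a₀ ≤ A₀. For t > 0 define F_τ(t)φ(q) = ∫_{ℝ^d} g_t^{τq + (1−τ)q₁}(q − q₁) φ(q₁) dq₁ with g_t^x(z) = (4πt)^{-d/2} (det A(x))^{-1/2} e^{-t c(x)} exp( −(z − t b(x))·A(x)^{-1}(z − t b(x)) / (4t) ), and define the differential operator L^τφ(q) = −tr( A(q)·Hess φ(q) ) + ( b(q) − 2(1−τ) div A(q) )·∇φ(q) + ( c(q) + (1−τ) div b(q) − (1−τ)² Σ_{i,j} ∂_i∂_j A_{ij}(q) ) φ(q), where div A is the vector with components Σ_j ∂_j A_{ij}. Then for every φ ∈ C_c^∞(ℝ^d), lim_{t→0+} ‖ (F_τ(t)φ − φ)/t + L^τφ ‖_{L¹(ℝ^d)} = 0. -/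

import Mathlib

open MeasureTheory Filter Topology Set RealInnerProductSpace

noncomputable section

/-- `ℝ^d` as a Euclidean space. -/
abbrev Ed (d : ℕ) := EuclideanSpace ℝ (Fin d)

/-- The `i`-th standard basis vector of `ℝ^d`. -/
def eb {d : ℕ} (i : Fin d) : Ed d := EuclideanSpace.single i (1 : ℝ)

/-- The quadratic form `p ↦ p · M p` of a matrix `M`. -/
def quadF {d : ℕ} (M : Matrix (Fin d) (Fin d) ℝ) (v : Ed d) : ℝ :=
  ∑ i, ∑ j, v i * M i j * v j

/-- The Gaussian-type kernel
`g_t^x(z) = (4πt)^{-d/2} (det A(x))^{-1/2} e^{-t c(x)} exp(−(z−t b(x))·A(x)⁻¹(z−t b(x))/(4t))`. -/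
def gker {d : ℕ} (A : Ed d → Matrix (Fin d) (Fin d) ℝ) (b : Ed d → Ed d) (c : Ed d → ℝ)
    (t : ℝ) (x z : Ed d) : ℝ :=
  (4 * Real.pi * t) ^ (-(d : ℝ) / 2) * (A x).det ^ (-(1 : ℝ) / 2) * Real.exp (-(t * c x)) *
    Real.exp (-(quadF (A x)⁻¹ (z - t • b x)) / (4 * t))

/-- The differential operator
`L^τφ = −tr(A·Hess φ) + (b − 2(1−τ) div A)·∇φ + (c + (1−τ) div b − (1−τ)² Σᵢⱼ ∂ᵢ∂ⱼAᵢⱼ)φ`. -/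
def Ltau {d : ℕ} (A : Ed d → Matrix (Fin d) (Fin d) ℝ) (b : Ed d → Ed d) (c : Ed d → ℝ)
    (τ : ℝ) (φ : Ed d → ℂ) (q : Ed d) : ℂ :=
  -(∑ i, ∑ j, ((A q i j : ℝ) : ℂ) *
      fderiv ℝ (fun x : Ed d => fderiv ℝ φ x (eb j)) q (eb i))
  + (∑ i, (((b q i - 2 * (1 - τ) *
        ∑ j, fderiv ℝ (fun x : Ed d => A x i j) q (eb j) : ℝ)) : ℂ) *
      fderiv ℝ φ q (eb i))
  + (((c q + (1 - τ) * ∑ j, fderiv ℝ (fun x : Ed d => b x j) q (eb j)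
      - (1 - τ) ^ 2 * ∑ i, ∑ j,
          fderiv ℝ (fun x : Ed d => fderiv ℝ (fun y : Ed d => A y i j) x (eb j)) q (eb i)
      : ℝ)) : ℂ) * φ q

/-- The integral operator `F_τ(t)φ(q) = ∫ g_t^{τq+(1−τ)q₁}(q − q₁)φ(q₁) dq₁` (with
`F_τ(0)φ = φ`). -/
def Fop {d : ℕ} (A : Ed d → Matrix (Fin d) (Fin d) ℝ) (b : Ed d → Ed d) (c : Ed d → ℝ)
    (τ : ℝ) (φ : Ed d → ℂ) (t : ℝ) (q : Ed d) : ℂ :=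
  if t = 0 then φ q
  else ∫ q₁ : Ed d, ((gker A b c t (τ • q + (1 - τ) • q₁) (q - q₁) : ℝ) : ℂ) * φ q₁


section GaussianMoments

variable {d : ℕ}

lemma integrable_pow_mul_gauss (n : ℕ) :
    Integrable (fun x : ℝ => x ^ n * Real.exp (-(1 / 4) * x ^ 2)) := by
  have h := integrable_rpow_mul_exp_neg_mul_sq (b := 1 / 4) (by norm_num) (s := (n : ℝ))
    (by have : (0 : ℝ) ≤ n := Nat.cast_nonneg n
        linarith)
  simpa using h

lemma integral_mul_gauss : ∫ x : ℝ, x * Real.exp (-(1 / 4) * x ^ 2) = 0 := by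
  have h := integral_neg_eq_self (fun x : ℝ => x * Real.exp (-(1 / 4) * x ^ 2)) volume
  simp only [neg_mul, even_two.neg_pow, integral_neg] at h
  simp only [neg_mul]
  linarith

lemma integral_sq_mul_gauss : ∫ x : ℝ, x ^ 2 * Real.exp (-(1 / 4) * x ^ 2)
    = 2 * ∫ x : ℝ, Real.exp (-(1 / 4) * x ^ 2) := by
  have hd : ∀ x : ℝ, HasDerivAt (fun x : ℝ => -2 * Real.exp (-(1 / 4) * x ^ 2))
      (x * Real.exp (-(1 / 4) * x ^ 2)) x := by
    intro x
    have h1 : HasDerivAt (fun x : ℝ => -(1 / 4) * x ^ 2) (-(1 / 4) * (2 * x)) x := by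
      simpa using (hasDerivAt_pow 2 x).const_mul (-(1 / 4 : ℝ))
    have h2 := (h1.exp).const_mul (-2)
    exact h2.congr_deriv (by ring)
  have i0 := integrable_pow_mul_gauss 0
  have i1 := integrable_pow_mul_gauss 1
  have i2 := integrable_pow_mul_gauss 2
  simp only [pow_zero, one_mul, pow_one] at i0 i1
  have key := integral_mul_deriv_eq_deriv_mul_of_integrable (u := fun x : ℝ => x)
    (v := fun x : ℝ => -2 * Real.exp (-(1 / 4) * x ^ 2)) (u' := fun _ => 1)
    (v' := fun x : ℝ => x * Real.exp (-(1 / 4) * x ^ 2))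
    (fun x _ => hasDerivAt_id x) (fun x _ => hd x)
    (by refine i2.congr (Eventually.of_forall fun x => ?_)
        simp only [Pi.mul_apply]; ring)
    (by refine (i0.const_mul (-2)).congr (Eventually.of_forall fun x => ?_)
        simp only [Pi.mul_apply]; ring)
    (by refine (i1.const_mul (-2)).congr (Eventually.of_forall fun x => ?_)
        simp only [Pi.mul_apply]; ring)
  calc ∫ x : ℝ, x ^ 2 * Real.exp (-(1 / 4) * x ^ 2)
      = ∫ x : ℝ, x * (x * Real.exp (-(1 / 4) * x ^ 2)) := by
        congr 1; ext x; ring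
    _ = _ := by
        rw [key]; simp only [one_mul]; rw [integral_const_mul]; ring

/-- The unnormalised standard Gaussian `exp (-‖y‖² / 4)` on `ℝ^d` as a product of
one-dimensional ones. -/
lemma exp_neg_norm_sq_eq_prod (y : Fin d → ℝ) :
    Real.exp (-(1 / 4) * ‖(WithLp.toLp 2 y : Ed d)‖ ^ 2)
      = ∏ k, Real.exp (-(1 / 4) * y k ^ 2) := by
  rw [← Real.exp_sum, EuclideanSpace.norm_sq_eq, Finset.mul_sum]
  simp

lemma integral_prod_pow_mul_gauss (n : Fin d → ℕ) :
    Integrable (fun y : Ed d => (∏ k, y k ^ n k) * Real.exp (-(1 / 4) * ‖y‖ ^ 2)) ∧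
    ∫ y : Ed d, (∏ k, y k ^ n k) * Real.exp (-(1 / 4) * ‖y‖ ^ 2)
      = ∏ k, ∫ x : ℝ, x ^ n k * Real.exp (-(1 / 4) * x ^ 2) := by
  have hmp := PiLp.volume_preserving_toLp (Fin d)
  have he : MeasurableEmbedding (WithLp.toLp 2 : (Fin d → ℝ) → Ed d) :=
    (MeasurableEquiv.toLp 2 (Fin d → ℝ)).measurableEmbedding
  have hfun : (fun y : Ed d => (∏ k, y k ^ n k) * Real.exp (-(1 / 4) * ‖y‖ ^ 2)) ∘
      (WithLp.toLp 2 : (Fin d → ℝ) → Ed d)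
      = fun y => ∏ k, (y k ^ n k * Real.exp (-(1 / 4) * y k ^ 2)) := by
    ext y
    simp only [Function.comp, exp_neg_norm_sq_eq_prod, Finset.prod_mul_distrib]
  constructor
  · rw [← hmp.integrable_comp_emb he, hfun]
    exact Integrable.fintype_prod (f := fun k (x : ℝ) => x ^ n k * Real.exp (-(1 / 4) * x ^ 2))
      fun k => integrable_pow_mul_gauss (n k)
  · rw [← hmp.integral_comp he]
    have := integral_fintype_prod_volume_eq_prod
      (fun k (x : ℝ) => x ^ n k * Real.exp (-(1 / 4) * x ^ 2))
    rw [← this]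
    exact integral_congr_ae (Eventually.of_forall fun y => congrFun hfun y)

lemma integral_gauss_eq : ∫ x : ℝ, Real.exp (-(1 / 4) * x ^ 2) = Real.sqrt (4 * Real.pi) := by
  rw [integral_gaussian]; congr 1; ring

/-- The total mass `(4π)^{d/2}` of `exp (-‖y‖² / 4)`. -/
def gaussMass (d : ℕ) : ℝ := Real.sqrt (4 * Real.pi) ^ d

lemma gaussMass_pos (d : ℕ) : 0 < gaussMass d := by
  unfold gaussMass; positivity

lemma gauss_moment_zero :
    Integrable (fun y : Ed d => Real.exp (-(1 / 4) * ‖y‖ ^ 2)) ∧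
    ∫ y : Ed d, Real.exp (-(1 / 4) * ‖y‖ ^ 2) = gaussMass d := by
  have h := integral_prod_pow_mul_gauss (d := d) (fun _ => 0)
  simp only [pow_zero, Finset.prod_const_one, one_mul, integral_gauss_eq, Finset.prod_const,
    Finset.card_univ, Fintype.card_fin] at h
  exact h

lemma gauss_moment_one (i : Fin d) :
    Integrable (fun y : Ed d => y i * Real.exp (-(1 / 4) * ‖y‖ ^ 2)) ∧
    ∫ y : Ed d, y i * Real.exp (-(1 / 4) * ‖y‖ ^ 2) = 0 := by
  have h := integral_prod_pow_mul_gauss (d := d) (Pi.single i 1)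
  have e : ∀ y : Ed d, ∏ k, y k ^ (Pi.single i 1 : Fin d → ℕ) k = y i := by
    intro y
    rw [Finset.prod_eq_single i]
    · simp
    · intro k _ hk; simp [hk]
    · simp
  simp only [e] at h
  refine ⟨h.1, h.2.trans (Finset.prod_eq_zero (Finset.mem_univ i) ?_)⟩
  simpa using integral_mul_gauss

lemma gauss_moment_two (i j : Fin d) :
    Integrable (fun y : Ed d => y i * y j * Real.exp (-(1 / 4) * ‖y‖ ^ 2)) ∧
    ∫ y : Ed d, y i * y j * Real.exp (-(1 / 4) * ‖y‖ ^ 2)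
      = if i = j then 2 * gaussMass d else 0 := by
  have e0 : ∀ (i : Fin d) (y : Ed d), ∏ k, y k ^ (Pi.single i 1 : Fin d → ℕ) k = y i := by
    intro i y
    rw [Finset.prod_eq_single i]
    · simp
    · intro k _ hk; simp [hk]
    · simp
  have h := integral_prod_pow_mul_gauss (d := d) (Pi.single i 1 + Pi.single j 1)
  have e : ∀ y : Ed d, ∏ k, y k ^ (Pi.single i 1 + Pi.single j 1 : Fin d → ℕ) k = y i * y j := by
    intro y
    simp only [Pi.add_apply, pow_add, Finset.prod_mul_distrib, e0]
  simp only [e] at h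
  refine ⟨h.1, h.2.trans ?_⟩
  split_ifs with hij
  · subst hij
    rw [← Finset.mul_prod_erase _ _ (Finset.mem_univ i)]
    rw [Finset.prod_congr rfl (g := fun _ => Real.sqrt (4 * Real.pi))]
    · have : (2 : ℝ) * gaussMass d = 2 * Real.sqrt (4 * Real.pi) * Real.sqrt (4 * Real.pi) ^ (d - 1) := by
        rw [gaussMass, mul_assoc, mul_pow_sub_one (by have := i.pos; omega)]
      rw [this]
      simp [integral_sq_mul_gauss, integral_gauss_eq, -neg_mul, -one_div, -Nat.reduceAdd]
    · intro k hk
      have hk' : k ≠ i := (Finset.mem_erase.mp hk).1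
      simp [hk', integral_gauss_eq, -neg_mul, -one_div]
  · refine Finset.prod_eq_zero (Finset.mem_univ i) ?_
    simpa [hij] using integral_mul_gauss

end GaussianMoments

section MatrixFacts

variable {d : ℕ}

lemma quadF_eq_dotProduct (M : Matrix (Fin d) (Fin d) ℝ) (v : Ed d) :
    quadF M v = v.ofLp ⬝ᵥ M.mulVec v.ofLp := by
  simp only [quadF, dotProduct, Matrix.mulVec, Finset.mul_sum, mul_assoc]

lemma norm_sq_eq_dotProduct (v : Ed d) : ‖v‖ ^ 2 = v.ofLp ⬝ᵥ v.ofLp := by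
  rw [EuclideanSpace.norm_sq_eq]; simp [dotProduct, pow_two]

lemma posDef_of_quadF {M : Matrix (Fin d) (Fin d) ℝ} (hM : M.IsSymm) {a : ℝ} (ha : 0 < a)
    (h : ∀ p : Ed d, a * ‖p‖ ^ 2 ≤ quadF M p) : M.PosDef := by
  refine Matrix.PosDef.of_dotProduct_mulVec_pos ?_ ?_
  · exact (Matrix.conjTranspose_eq_transpose_of_trivial M).trans hM
  · intro x hx
    have h1 := h (WithLp.toLp 2 x)
    rw [quadF_eq_dotProduct] at h1
    have h2 : 0 < ‖(WithLp.toLp 2 x : Ed d)‖ := by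
      rw [norm_pos_iff]; simpa using hx
    simp only [star_trivial]
    exact lt_of_lt_of_le (by positivity) h1

lemma pow_le_det_of_quadF {M : Matrix (Fin d) (Fin d) ℝ} (hM : M.IsSymm) {a : ℝ} (ha : 0 < a)
    (h : ∀ p : Ed d, a * ‖p‖ ^ 2 ≤ quadF M p) : a ^ d ≤ M.det := by
  have hH : M.IsHermitian := (posDef_of_quadF hM ha h).1
  rw [hH.det_eq_prod_eigenvalues]
  have : ∀ i, a ≤ hH.eigenvalues i := by
    intro i
    rw [hH.eigenvalues_eq]
    have h1 := h (hH.eigenvectorBasis i)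
    rw [quadF_eq_dotProduct, hH.eigenvectorBasis.orthonormal.1 i] at h1
    simpa using h1
  calc a ^ d = ∏ _i : Fin d, a := by simp
    _ ≤ ∏ i, hH.eigenvalues i := Finset.prod_le_prod (fun _ _ => ha.le) fun i _ => this i
    _ = _ := by simp

lemma le_quadF_inv {M : Matrix (Fin d) (Fin d) ℝ} (hM : M.PosDef) {a : ℝ} (ha : 0 < a)
    (h : ∀ p : Ed d, quadF M p ≤ a * ‖p‖ ^ 2) (v : Ed d) : a⁻¹ * ‖v‖ ^ 2 ≤ quadF M⁻¹ v := by
  have hdet : IsUnit M.det := hM.det_pos.ne'.isUnit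
  have hT : M.transpose = M := by simpa [Matrix.IsHermitian] using hM.1
  set u : Fin d → ℝ := M⁻¹.mulVec v.ofLp with hu
  have hMu : M.mulVec u = v.ofLp := by
    rw [hu, Matrix.mulVec_mulVec, Matrix.mul_nonsing_inv _ hdet, Matrix.one_mulVec]
  have h0 : 0 ≤ (a⁻¹ • v.ofLp - u) ⬝ᵥ M.mulVec (a⁻¹ • v.ofLp - u) := by
    have := hM.posSemidef.dotProduct_mulVec_nonneg (a⁻¹ • v.ofLp - u)
    simpa using this
  have h1 := h v
  rw [quadF_eq_dotProduct, norm_sq_eq_dotProduct] at h1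
  rw [quadF_eq_dotProduct, norm_sq_eq_dotProduct, ← hu]
  have h3 : u ⬝ᵥ M.mulVec v.ofLp = v.ofLp ⬝ᵥ v.ofLp := by
    rw [Matrix.dotProduct_mulVec, ← Matrix.mulVec_transpose, hT, hMu]
  rw [Matrix.mulVec_sub, Matrix.mulVec_smul, hMu] at h0
  simp only [sub_dotProduct, dotProduct_sub, smul_dotProduct, dotProduct_smul, smul_eq_mul, h3]
    at h0
  rw [dotProduct_comm u] at h0
  have h4 : a⁻¹ * (a⁻¹ * (v.ofLp ⬝ᵥ M.mulVec v.ofLp)) ≤ a⁻¹ * (v.ofLp ⬝ᵥ v.ofLp) := by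
    have : a⁻¹ * (v.ofLp ⬝ᵥ M.mulVec v.ofLp) ≤ v.ofLp ⬝ᵥ v.ofLp := by
      rw [inv_mul_le_iff₀ ha]; exact h1
    exact mul_le_mul_of_nonneg_left this (inv_nonneg.mpr ha.le)
  linarith

lemma integral_comp_add_linearMap (f : Ed d →ₗ[ℝ] Ed d) (hf : LinearMap.det f ≠ 0) (β : Ed d)
    (g : Ed d → ℝ) :
    (Integrable (fun y => g (β + f y)) → Integrable g) ∧
    ∫ w, g w = |LinearMap.det f| * ∫ y, g (β + f y) := by
  have he : MeasurableEmbedding f :=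
    (LinearMap.equivOfDetNeZero f hf).toContinuousLinearEquiv.toHomeomorph.measurableEmbedding
  have hmap := Measure.map_linearMap_addHaar_eq_smul_addHaar (volume : Measure (Ed d)) hf
  have hc : ENNReal.ofReal |(LinearMap.det f)⁻¹| ≠ 0 := by
    simpa using hf
  constructor
  · intro h
    have h1 : Integrable (fun y => g (β + y)) (Measure.map f volume) :=
      (he.integrable_map_iff).mpr h
    rw [hmap, integrable_smul_measure hc ENNReal.ofReal_ne_top] at h1
    simpa using h1.comp_add_left (-β)
  · have h1 : ∫ y, g (β + f y) = ∫ y, g (β + y) ∂(Measure.map f volume) :=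
      (he.integral_map (fun y => g (β + y))).symm
    rw [h1, hmap, integral_smul_measure, integral_add_left_eq_self,
      ENNReal.toReal_ofReal (abs_nonneg _), smul_eq_mul, ← mul_assoc, ← abs_mul,
      mul_inv_cancel₀ hf, abs_one, one_mul]

/-- The Gaussian density with mean `β` and covariance matrix `2 M`. -/
def gaussDens (M : Matrix (Fin d) (Fin d) ℝ) (β w : Ed d) : ℝ :=
  (gaussMass d)⁻¹ * M.det ^ (-(1 : ℝ) / 2) * Real.exp (-(quadF M⁻¹ (w - β)) / 4)

open scoped MatrixOrder ComplexOrder in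
lemma exists_linear_sqrt {M : Matrix (Fin d) (Fin d) ℝ} (hM : M.PosDef) :
    ∃ S : Matrix (Fin d) (Fin d) ℝ, S * S.transpose = M ∧ S.det = Real.sqrt M.det := by
  refine ⟨CFC.sqrt M, ?_, ?_⟩
  · have h1 : (CFC.sqrt M).PosSemidef := Matrix.nonneg_iff_posSemidef.mp (CFC.sqrt_nonneg M)
    have h2 : (CFC.sqrt M).transpose = CFC.sqrt M := by
      simpa [Matrix.IsHermitian] using h1.1
    rw [h2]
    exact CFC.sqrt_mul_sqrt_self M hM.posSemidef.nonneg
  · simpa using hM.posSemidef.det_sqrt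

lemma gaussDens_comp {M S : Matrix (Fin d) (Fin d) ℝ} (hM : M.PosDef)
    (hS : S * S.transpose = M) (hdet : S.det = Real.sqrt M.det) (β y : Ed d) :
    gaussDens M β (β + Matrix.toLpLin 2 2 S y)
      = (gaussMass d)⁻¹ * (S.det)⁻¹ * Real.exp (-(1 / 4) * ‖y‖ ^ 2) := by
  have hMdet := hM.det_pos
  have hSdet : IsUnit S.det := by
    rw [hdet]; exact (Real.sqrt_pos.mpr hMdet).ne'.isUnit
  have hTdet : IsUnit S.transpose.det := by rwa [Matrix.det_transpose]
  unfold gaussDens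
  have h1 : quadF M⁻¹ (β + Matrix.toLpLin 2 2 S y - β) = ‖y‖ ^ 2 := by
    rw [add_sub_cancel_left, quadF_eq_dotProduct, norm_sq_eq_dotProduct]
    simp only [Matrix.ofLp_toLpLin, Matrix.toLin'_apply]
    rw [← hS, Matrix.mul_inv_rev, Matrix.mulVec_mulVec, Matrix.mul_assoc,
      Matrix.nonsing_inv_mul _ hSdet, Matrix.mul_one, Matrix.dotProduct_mulVec,
      ← Matrix.mulVec_transpose, Matrix.mulVec_mulVec, ← Matrix.transpose_nonsing_inv,
      Matrix.transpose_transpose, Matrix.nonsing_inv_mul _ hSdet, Matrix.one_mulVec]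
  have h2 : M.det ^ (-(1 : ℝ) / 2) = (S.det)⁻¹ := by
    rw [hdet, Real.sqrt_eq_rpow, ← Real.rpow_neg hMdet.le]; norm_num
  rw [h1, h2]
  congr 2
  ring

/-- Moments of the Gaussian density up to order two. -/
lemma gaussDens_moments {M : Matrix (Fin d) (Fin d) ℝ} (hM : M.PosDef) (β : Ed d) :
    (∫ w, gaussDens M β w = 1) ∧
    (∀ i, ∫ w, w i * gaussDens M β w = β i) ∧
    (∀ i j, ∫ w, w i * w j * gaussDens M β w = 2 * M i j + β i * β j) := by
  obtain ⟨S, hS, hdet⟩ := exists_linear_sqrt hM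
  have hpos : 0 < S.det := by rw [hdet]; exact Real.sqrt_pos.mpr hM.det_pos
  have hf : LinearMap.det (Matrix.toLpLin 2 2 S) = S.det := by
    simp [Matrix.toLpLin_eq_toLin]
  have hf0 : LinearMap.det (Matrix.toLpLin 2 2 S) ≠ 0 := by rw [hf]; exact hpos.ne'
  have hm := gaussMass_pos d
  have hcoord : ∀ (y : Ed d) i, (β + Matrix.toLpLin 2 2 S y) i = β i + ∑ k, S i k * y k := by
    intro y i
    simp [Matrix.mulVec, dotProduct]
  set G : Ed d → ℝ := fun y => Real.exp (-(1 / 4) * ‖y‖ ^ 2) with hG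
  have i0 : Integrable G := gauss_moment_zero.1
  have m0 : ∫ y, G y = gaussMass d := gauss_moment_zero.2
  have i1 : ∀ i, Integrable (fun y : Ed d => y i * G y) := fun i => (gauss_moment_one i).1
  have m1 : ∀ i, ∫ y : Ed d, y i * G y = 0 := fun i => (gauss_moment_one i).2
  have i2 : ∀ i j, Integrable (fun y : Ed d => y i * y j * G y) :=
    fun i j => (gauss_moment_two i j).1
  have m2 : ∀ i j, ∫ y : Ed d, y i * y j * G y = if i = j then 2 * gaussMass d else 0 :=
    fun i j => (gauss_moment_two i j).2
  have key : ∀ p : Ed d → ℝ, ∫ w, p w * gaussDens M β w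
      = (gaussMass d)⁻¹ * ∫ y, p (β + Matrix.toLpLin 2 2 S y) * G y := by
    intro p
    rw [(integral_comp_add_linearMap _ hf0 β _).2, hf, abs_of_pos hpos, ← integral_const_mul,
      ← integral_const_mul]
    congr 1
    ext y
    rw [gaussDens_comp hM hS hdet]
    simp only [hG]
    field_simp
  have l1 : ∀ i, Integrable (fun y : Ed d => (∑ k, S i k * y k) * G y) ∧
      ∫ y : Ed d, (∑ k, S i k * y k) * G y = 0 := by
    intro i
    have e : (fun y : Ed d => (∑ k, S i k * y k) * G y)
        = fun y => ∑ k, S i k * (y k * G y) := by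
      ext y; rw [Finset.sum_mul]; exact Finset.sum_congr rfl fun k _ => by ring
    rw [e]
    refine ⟨integrable_finsetSum _ fun k _ => (i1 k).const_mul _, ?_⟩
    rw [integral_finsetSum _ fun k _ => (i1 k).const_mul _]
    simp [integral_const_mul, m1]
  have l2 : ∀ i j, Integrable
      (fun y : Ed d => (∑ k, S i k * y k) * (∑ k, S j k * y k) * G y) ∧
      ∫ y : Ed d, (∑ k, S i k * y k) * (∑ k, S j k * y k) * G y
        = 2 * gaussMass d * M i j := by
    intro i j
    have e : (fun y : Ed d => (∑ k, S i k * y k) * (∑ k, S j k * y k) * G y)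
        = fun y => ∑ k, ∑ l, S i k * S j l * (y k * y l * G y) := by
      ext y
      rw [Finset.sum_mul_sum, Finset.sum_mul]
      refine Finset.sum_congr rfl fun k _ => ?_
      rw [Finset.sum_mul]
      exact Finset.sum_congr rfl fun l _ => by ring
    rw [e]
    refine ⟨integrable_finsetSum _ fun k _ => integrable_finsetSum _ fun l _ =>
      (i2 k l).const_mul _, ?_⟩
    rw [integral_finsetSum _ fun k _ => integrable_finsetSum _ fun l _ => (i2 k l).const_mul _]
    have : ∀ k, ∫ y : Ed d, ∑ l, S i k * S j l * (y k * y l * G y)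
        = 2 * gaussMass d * (S i k * S.transpose k j) := by
      intro k
      rw [integral_finsetSum _ fun l _ => (i2 k l).const_mul _]
      simp [integral_const_mul, m2, Matrix.transpose_apply]
      ring
    simp only [this]
    rw [← Finset.mul_sum, ← hS, Matrix.mul_apply]
  refine ⟨?_, fun i => ?_, fun i j => ?_⟩
  · have := key (fun _ => 1)
    simp only [one_mul] at this
    rw [this, m0, inv_mul_cancel₀ hm.ne']
  · rw [key (fun w => w i)]
    simp only [hcoord, add_mul]
    rw [integral_add (i0.const_mul _) (l1 i).1, integral_const_mul, m0, (l1 i).2]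
    field_simp
    ring
  · rw [key (fun w => w i * w j)]
    simp only [hcoord]
    have e : ∀ y : Ed d, (β i + ∑ k, S i k * y k) * (β j + ∑ k, S j k * y k) * G y
        = β i * β j * G y + β i * ((∑ k, S j k * y k) * G y)
          + β j * ((∑ k, S i k * y k) * G y)
          + (∑ k, S i k * y k) * (∑ k, S j k * y k) * G y := fun y => by ring
    simp only [e]
    have ia : Integrable (fun y => β i * β j * G y) := i0.const_mul _
    have ib : Integrable (fun y : Ed d => β i * ((∑ k, S j k * y k) * G y)) :=
      (l1 j).1.const_mul _
    have ic : Integrable (fun y : Ed d => β j * ((∑ k, S i k * y k) * G y)) :=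
      (l1 i).1.const_mul _
    have iab : Integrable (fun y : Ed d => β i * β j * G y
        + β i * ((∑ k, S j k * y k) * G y)) := ia.add ib
    have iabc : Integrable (fun y : Ed d => β i * β j * G y
        + β i * ((∑ k, S j k * y k) * G y) + β j * ((∑ k, S i k * y k) * G y)) := iab.add ic
    rw [integral_add iabc (l2 i j).1, integral_add iab ic, integral_add ia ib,
      integral_const_mul, integral_const_mul, integral_const_mul, m0, (l1 i).2, (l1 j).2,
      (l2 i j).2]
    field_simp
    ring

end MatrixFacts

section FamilyBounds

variable {E P : Type*} [NormedAddCommGroup E] [NormedSpace ℝ E]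

/-- A family `f p` of `C³` functions whose derivatives up to order three are bounded by a
multiple of `B p`, uniformly in `p` and in space. -/
def FamBound (f : P → E → ℝ) (B : P → ℝ) : Prop :=
  (∀ p, ContDiff ℝ 3 (f p)) ∧
    ∃ K, 0 ≤ K ∧ ∀ p, ∀ k : ℕ, k ≤ 3 → ∀ x, ‖iteratedFDeriv ℝ k (f p) x‖ ≤ K * B p

lemma sum_choose_mul_le {k : ℕ} (hk : k ≤ 3) {u v : ℕ → ℝ} {a b : ℝ} (hu : ∀ i, i ≤ 3 → u i ≤ a)
    (hv : ∀ i, i ≤ 3 → v i ≤ b) (hu0 : ∀ i, 0 ≤ u i) (hv0 : ∀ i, 0 ≤ v i) :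
    ∑ i ∈ Finset.range (k + 1), (k.choose i : ℝ) * u i * v (k - i) ≤ 8 * (a * b) := by
  have ha : 0 ≤ a := (hu0 0).trans (hu 0 (by norm_num))
  have hb : 0 ≤ b := (hv0 0).trans (hv 0 (by norm_num))
  calc ∑ i ∈ Finset.range (k + 1), (k.choose i : ℝ) * u i * v (k - i)
      ≤ ∑ i ∈ Finset.range (k + 1), (k.choose i : ℝ) * (a * b) := by
        refine Finset.sum_le_sum fun i hi => ?_
        have hi' : i ≤ k := Nat.lt_succ_iff.mp (Finset.mem_range.mp hi)
        rw [mul_assoc]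
        refine mul_le_mul_of_nonneg_left ?_ (Nat.cast_nonneg _)
        exact mul_le_mul (hu i (by omega)) (hv (k - i) (by omega)) (hv0 _) ha
    _ = 2 ^ k * (a * b) := by
        rw [← Finset.sum_mul]
        congr 1
        exact_mod_cast Nat.sum_range_choose k
    _ ≤ 8 * (a * b) := by
        refine mul_le_mul_of_nonneg_right ?_ (mul_nonneg ha hb)
        calc (2 : ℝ) ^ k ≤ 2 ^ 3 := pow_le_pow_right₀ (by norm_num) hk
          _ = 8 := by norm_num

namespace FamBound

variable {f g : P → E → ℝ} {B B' : P → ℝ}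

lemma mono (hf : FamBound f B) (h : ∀ p, B p ≤ B' p) : FamBound f B' := by
  obtain ⟨h1, K, hK, h2⟩ := hf
  exact ⟨h1, K, hK, fun p k hk x => (h2 p k hk x).trans (mul_le_mul_of_nonneg_left (h p) hK)⟩

lemma const {a : P → ℝ} (h : ∀ p, |a p| ≤ B p) : FamBound (fun p (_ : E) => a p) B := by
  refine ⟨fun p => contDiff_const, 1, zero_le_one, fun p k _ x => ?_⟩
  rw [one_mul]
  rcases Nat.eq_zero_or_pos k with rfl | hk
  · rw [norm_iteratedFDeriv_zero]; exact h p
  · rw [iteratedFDeriv_const_of_ne hk.ne']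
    simpa using (abs_nonneg _).trans (h p)

lemma add (hf : FamBound f B) (hg : FamBound g B) : FamBound (fun p x => f p x + g p x) B := by
  obtain ⟨h1, K, hK, h2⟩ := hf
  obtain ⟨h1', K', hK', h2'⟩ := hg
  refine ⟨fun p => (h1 p).add (h1' p), K + K', add_nonneg hK hK', fun p k hk x => ?_⟩
  have hk' : (k : WithTop ℕ∞) ≤ 3 := by exact_mod_cast hk
  have := iteratedFDeriv_add_apply (x := x) (((h1 p).of_le hk').contDiffAt)
    (((h1' p).of_le hk').contDiffAt)
  change ‖iteratedFDeriv ℝ k (f p + g p) x‖ ≤ _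
  rw [this, add_mul]
  exact (norm_add_le _ _).trans (add_le_add (h2 p k hk x) (h2' p k hk x))

lemma mul (hf : FamBound f B) (hg : FamBound g B') :
    FamBound (fun p x => f p x * g p x) (fun p => B p * B' p) := by
  obtain ⟨h1, K, hK, h2⟩ := hf
  obtain ⟨h1', K', hK', h2'⟩ := hg
  refine ⟨fun p => (h1 p).mul (h1' p), 8 * (K * K'), by positivity, fun p k hk x => ?_⟩
  have hk' : (k : WithTop ℕ∞) ≤ 3 := by exact_mod_cast hk
  refine (norm_iteratedFDeriv_mul_le (h1 p) (h1' p) x hk').trans ?_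
  refine (sum_choose_mul_le hk (fun i hi => h2 p i hi x) (fun i hi => h2' p i hi x)
    (fun _ => norm_nonneg _) (fun _ => norm_nonneg _)).trans (le_of_eq (by ring))

lemma sum {ι : Type*} (s : Finset ι) {f : ι → P → E → ℝ} (hB : ∀ p, 0 ≤ B p)
    (hf : ∀ i ∈ s, FamBound (f i) B) : FamBound (fun p x => ∑ i ∈ s, f i p x) B := by
  classical
  induction s using Finset.induction_on with
  | empty => simpa using FamBound.const (a := fun _ => 0) (by simpa using hB)
  | insert a s ha ih =>
    simp only [Finset.sum_insert ha]
    exact (hf a (Finset.mem_insert_self a s)).add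
      (ih fun i hi => hf i (Finset.mem_insert_of_mem hi))

lemma prod_one {ι : Type*} (s : Finset ι) {f : ι → P → E → ℝ}
    (hf : ∀ i ∈ s, FamBound (f i) (fun _ => 1)) :
    FamBound (fun p x => ∏ i ∈ s, f i p x) (fun _ => 1) := by
  classical
  induction s using Finset.induction_on with
  | empty => simpa using FamBound.const (a := fun _ => 1) (by simp)
  | insert a s ha ih =>
    simp only [Finset.prod_insert ha]
    simpa using (hf a (Finset.mem_insert_self a s)).mul
      (ih fun i hi => hf i (Finset.mem_insert_of_mem hi))

lemma det_one {d : ℕ} {M : P → E → Matrix (Fin d) (Fin d) ℝ}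
    (h : ∀ i j, FamBound (fun p x => M p x i j) (fun _ => 1)) :
    FamBound (fun p x => (M p x).det) (fun _ => 1) := by
  simp only [Matrix.det_apply']
  refine FamBound.sum _ (fun _ => zero_le_one) fun σ _ => ?_
  have h1 : FamBound (fun (_ : P) (_ : E) => ((Equiv.Perm.sign σ : ℤ) : ℝ)) (fun _ => 1) := by
    refine FamBound.const fun p => ?_
    rcases Int.units_eq_one_or (Equiv.Perm.sign σ) with h | h <;> simp [h]
  simpa using h1.mul (FamBound.prod_one _ fun i _ => h (σ i) i)

lemma adjugate_one {d : ℕ} {M : P → E → Matrix (Fin d) (Fin d) ℝ}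
    (h : ∀ i j, FamBound (fun p x => M p x i j) (fun _ => 1)) (i j : Fin d) :
    FamBound (fun p x => (M p x).adjugate i j) (fun _ => 1) := by
  simp only [Matrix.adjugate_apply]
  refine FamBound.det_one fun k l => ?_
  by_cases hk : k = j
  · subst hk
    simp only [Matrix.updateRow_self]
    refine FamBound.const fun p => ?_
    by_cases hl : l = i <;> simp [hl]
  · simpa only [Matrix.updateRow_ne hk] using h k l

/-- Composition with a function which is smooth near the compact range `[δ, Δ]`. -/
lemma comp_one (hf : FamBound f (fun _ => 1)) {g : ℝ → ℝ} {δ Δ : ℝ} (hδ : 0 < δ)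
    (hg : ContDiffOn ℝ 3 g (Ioi 0)) (hr : ∀ p x, f p x ∈ Icc δ Δ) :
    FamBound (fun p x => g (f p x)) (fun _ => 1) := by
  obtain ⟨h1, K, hK, h2⟩ := hf
  have hpos : ∀ p x, f p x ∈ Ioi (0 : ℝ) := fun p x => lt_of_lt_of_le hδ (hr p x).1
  have hbd : ∀ i : ℕ, ∃ C, i ≤ 3 → ∀ y ∈ Icc δ Δ, ‖iteratedFDerivWithin ℝ i g (Ioi 0) y‖ ≤ C := by
    intro i
    by_cases hi : i ≤ 3
    · have hc : ContinuousOn (iteratedFDerivWithin ℝ i g (Ioi 0)) (Icc δ Δ) :=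
        (hg.continuousOn_iteratedFDerivWithin (by exact_mod_cast hi)
          (uniqueDiffOn_Ioi 0)).mono fun y hy => lt_of_lt_of_le hδ hy.1
      obtain ⟨C, hC⟩ := isCompact_Icc.exists_bound_of_continuousOn hc
      exact ⟨C, fun _ => hC⟩
    · exact ⟨0, fun h => absurd h hi⟩
  choose C hC using hbd
  set C' : ℝ := ∑ i ∈ Finset.range 4, |C i| with hC'
  have hC'i : ∀ i, i ≤ 3 → C i ≤ C' := fun i hi =>
    (le_abs_self _).trans (Finset.single_le_sum (f := fun i => |C i|)
      (fun _ _ => abs_nonneg _) (Finset.mem_range.mpr (by omega)))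
  have hC'0 : 0 ≤ C' := Finset.sum_nonneg fun _ _ => abs_nonneg _
  have hcd : ∀ p, ContDiff ℝ 3 (fun x => g (f p x)) := fun p => by
    rw [← contDiffOn_univ]
    exact hg.comp (h1 p).contDiffOn fun x _ => hpos p x
  refine ⟨hcd, 6 * C' * (K + 1) ^ 3, by positivity, fun p k hk x => ?_⟩
  rw [← iteratedFDerivWithin_univ]
  have hk' : (k : WithTop ℕ∞) ≤ 3 := by exact_mod_cast hk
  have := norm_iteratedFDerivWithin_comp_le hg (h1 p).contDiffOn hk' (uniqueDiffOn_Ioi 0)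
    uniqueDiffOn_univ (fun x _ => hpos p x) (mem_univ x) (C := C') (D := K + 1)
    (fun i hi => (hC i (hi.trans hk) _ (hr p x)).trans (hC'i i (hi.trans hk)))
    (fun i hi1 hi => by
      rw [iteratedFDerivWithin_univ]
      calc _ ≤ K * 1 := h2 p i (hi.trans hk) x
        _ ≤ K + 1 := by linarith
        _ ≤ (K + 1) ^ i := le_self_pow₀ (by linarith) (by omega))
  refine this.trans ?_
  have hfac : (k.factorial : ℝ) ≤ 6 := by
    exact_mod_cast (Nat.factorial_le hk).trans (le_of_eq (by decide))
  have hp : (K + 1) ^ k ≤ (K + 1) ^ 3 := pow_le_pow_right₀ (by linarith) hk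
  rw [mul_one]
  exact mul_le_mul (mul_le_mul_of_nonneg_right hfac hC'0) hp (by positivity) (by positivity)

/-- The exponential of a family bounded below. -/
lemma exp_neg (hf : FamBound f B) (hB : ∀ p, 1 ≤ B p) {β : P → ℝ} {c : ℝ} (hc : 0 ≤ c)
    (hlow : ∀ p x, Real.exp (-f p x) ≤ c * β p) :
    FamBound (fun p x => Real.exp (-f p x)) (fun p => β p * B p ^ 3) := by
  obtain ⟨h1, K, hK, h2⟩ := hf
  refine ⟨fun p => (h1 p).neg.exp, 6 * c * (K + 1) ^ 3, by positivity, fun p k hk x => ?_⟩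
  have hk' : (k : WithTop ℕ∞) ≤ 3 := by exact_mod_cast hk
  have hKB : 1 ≤ (K + 1) * B p := by nlinarith [hB p]
  have hneg : ContDiff ℝ 3 (fun x => -f p x) := (h1 p).neg
  have := norm_iteratedFDeriv_comp_le (g := Real.exp) (f := fun x => -f p x) (n := k)
    Real.contDiff_exp hneg hk' x (C := c * β p) (D := (K + 1) * B p)
    (fun i hi => by
      rw [norm_iteratedFDeriv_eq_norm_iteratedDeriv, iteratedDeriv_eq_iterate,
        Real.iter_deriv_exp, Real.norm_eq_abs, Real.abs_exp]
      exact hlow p x)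
    (fun i hi1 hi => by
      have e : (fun x => -f p x) = -f p := rfl
      rw [e, iteratedFDeriv_neg_apply, norm_neg]
      calc _ ≤ K * B p := h2 p i (hi.trans hk) x
        _ ≤ (K + 1) * B p := by nlinarith [hB p]
        _ ≤ ((K + 1) * B p) ^ i := le_self_pow₀ hKB (by omega))
  refine this.trans ?_
  have hfac : (k.factorial : ℝ) ≤ 6 := by
    exact_mod_cast (Nat.factorial_le hk).trans (le_of_eq (by decide))
  have hcb : 0 ≤ c * β p := (Real.exp_pos _).le.trans (hlow p x)
  have hp : ((K + 1) * B p) ^ k ≤ ((K + 1) * B p) ^ 3 := pow_le_pow_right₀ hKB hk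
  calc (k.factorial : ℝ) * (c * β p) * ((K + 1) * B p) ^ k
      ≤ 6 * (c * β p) * ((K + 1) * B p) ^ 3 := by gcongr
    _ = _ := by ring

end FamBound

end FamilyBounds

section KernelBounds

variable {d : ℕ}

lemma exists_one_add_pow_le_exp (n : ℕ) {β : ℝ} (hβ : 0 < β) :
    ∃ K, 0 < K ∧ ∀ x : ℝ, 0 ≤ x → (1 + x) ^ n ≤ K * Real.exp (β * x ^ 2) := by
  set γ : ℝ := β / (n + 1) with hγ
  have hγ0 : 0 < γ := by positivity
  refine ⟨(2 + 1 / γ) ^ n, by positivity, fun x hx => ?_⟩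
  have h1 : 1 + x ≤ (2 + 1 / γ) * Real.exp (γ * x ^ 2) := by
    have h2 : γ * x ^ 2 + 1 ≤ Real.exp (γ * x ^ 2) := Real.add_one_le_exp _
    have h3 : 1 + x ≤ (2 + 1 / γ) * (γ * x ^ 2 + 1) := by
      have e : (2 + 1 / γ) * (γ * x ^ 2 + 1) = 2 * γ * x ^ 2 + 2 + x ^ 2 + 1 / γ := by
        field_simp
        ring
      rw [e]
      have : 0 < 1 / γ := by positivity
      nlinarith [sq_nonneg (x - 1), mul_nonneg hγ0.le (sq_nonneg x)]
    exact h3.trans (mul_le_mul_of_nonneg_left h2 (by positivity))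
  calc (1 + x) ^ n ≤ ((2 + 1 / γ) * Real.exp (γ * x ^ 2)) ^ n := by gcongr
    _ = (2 + 1 / γ) ^ n * Real.exp (n * (γ * x ^ 2)) := by
        rw [mul_pow, ← Real.exp_nat_mul]
    _ ≤ _ := by
        refine mul_le_mul_of_nonneg_left (Real.exp_le_exp.mpr ?_) (by positivity)
        rw [← mul_assoc]
        refine mul_le_mul_of_nonneg_right ?_ (sq_nonneg x)
        rw [hγ, mul_div_assoc', div_le_iff₀ (by positivity)]
        nlinarith

lemma FamBound.reindex {E P P' : Type*} [NormedAddCommGroup E] [NormedSpace ℝ E]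
    {f : P → E → ℝ} {B : P → ℝ} (hf : FamBound f B) (e : P' → P) :
    FamBound (fun p => f (e p)) (fun p => B (e p)) := by
  obtain ⟨h1, K, hK, h2⟩ := hf
  exact ⟨fun p => h1 (e p), K, hK, fun p => h2 (e p)⟩

/-- Bounded, uniformly elliptic coefficients with bounded derivatives up to order three. -/
structure EllipticCoeffs (A : Ed d → Matrix (Fin d) (Fin d) ℝ) (b : Ed d → Ed d)
    (a₀ A₀ : ℝ) : Prop where
  symm : ∀ q, (A q).IsSymm
  pos : 0 < a₀
  pos' : 0 < A₀
  lower : ∀ q p : Ed d, a₀ * ‖p‖ ^ 2 ≤ quadF (A q) p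
  upper : ∀ q p : Ed d, quadF (A q) p ≤ A₀ * ‖p‖ ^ 2
  boundA : ∀ i j, FamBound (fun (_ : Unit) q => A q i j) (fun _ => 1)
  boundb : ∀ i, FamBound (fun (_ : Unit) q => b q i) (fun _ => 1)
  normb : ∃ C, ∀ q, ‖b q‖ ≤ C

/-- The rescaled transition kernel: the Gaussian density with mean `r b(x)` and covariance
`2 A(x)`. -/
def kern (A : Ed d → Matrix (Fin d) (Fin d) ℝ) (b : Ed d → Ed d) (r : ℝ) (x w : Ed d) : ℝ :=
  gaussDens (A x) (r • b x) w

namespace EllipticCoeffs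

variable {A : Ed d → Matrix (Fin d) (Fin d) ℝ} {b : Ed d → Ed d} {a₀ A₀ : ℝ}

lemma posDef (h : EllipticCoeffs A b a₀ A₀) (q : Ed d) : (A q).PosDef :=
  posDef_of_quadF (h.symm q) h.pos (h.lower q)

lemma det_mem (h : EllipticCoeffs A b a₀ A₀) : ∃ Δ, ∀ q, (A q).det ∈ Icc (a₀ ^ d) Δ := by
  obtain ⟨-, K, -, hK⟩ := FamBound.det_one (M := fun (_ : Unit) q => A q) h.boundA
  refine ⟨K * 1, fun q => ⟨pow_le_det_of_quadF (h.symm q) h.pos (h.lower q), ?_⟩⟩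
  have := hK () 0 (by norm_num) q
  rw [norm_iteratedFDeriv_zero] at this
  exact (le_abs_self _).trans this

lemma bound_inv (h : EllipticCoeffs A b a₀ A₀) (i j : Fin d) :
    FamBound (fun (_ : Unit) q => (A q)⁻¹ i j) (fun _ => 1) := by
  obtain ⟨Δ, hΔ⟩ := h.det_mem
  have h1 : FamBound (fun (_ : Unit) q => ((A q).det)⁻¹) (fun _ => 1) :=
    (FamBound.det_one (M := fun (_ : Unit) q => A q) h.boundA).comp_one
      (g := fun y => y⁻¹) (pow_pos h.pos d)
      (contDiffOn_id.inv fun y hy => (ne_of_gt hy)) fun _ q => hΔ q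
  have h2 := h1.mul (FamBound.adjugate_one (M := fun (_ : Unit) q => A q) h.boundA i j)
  simp only [mul_one] at h2
  convert h2 using 3
  simp [Matrix.inv_def, Ring.inverse_eq_inv']

lemma bound_prefactor (h : EllipticCoeffs A b a₀ A₀) :
    FamBound (fun (_ : Unit) q => (gaussMass d)⁻¹ * (A q).det ^ (-(1 : ℝ) / 2))
      (fun _ => 1) := by
  obtain ⟨Δ, hΔ⟩ := h.det_mem
  refine (FamBound.det_one (M := fun (_ : Unit) q => A q) h.boundA).comp_one
      (g := fun y => (gaussMass d)⁻¹ * y ^ (-(1 : ℝ) / 2)) (pow_pos h.pos d) ?_ fun _ q => hΔ q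
  exact contDiffOn_const.mul (contDiffOn_id.rpow_const_of_ne fun y hy => (ne_of_gt hy))

lemma kern_eq (r : ℝ) (x w : Ed d) : kern A b r x w =
    ((gaussMass d)⁻¹ * (A x).det ^ (-(1 : ℝ) / 2)) *
      Real.exp (-(∑ i, ∑ j, 1 / 4 * (((w i - r * b x i) * (A x)⁻¹ i j) * (w j - r * b x j)))) := by
  unfold kern gaussDens quadF
  congr 2
  rw [neg_div, Finset.sum_div]
  congr 1
  refine Finset.sum_congr rfl fun i _ => ?_
  rw [Finset.sum_div]
  refine Finset.sum_congr rfl fun j _ => ?_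
  simp only [PiLp.sub_apply, PiLp.smul_apply, smul_eq_mul]
  ring

lemma contDiff_kern (h : EllipticCoeffs A b a₀ A₀) (r : ℝ) :
    ContDiff ℝ 3 (fun p : Ed d × Ed d => kern A b r p.1 p.2) := by
  simp only [kern_eq]
  have h1 := h.bound_prefactor.1 ()
  have h2 := fun i j => (h.bound_inv i j).1 ()
  have h3 := fun i => (h.boundb i).1 ()
  have h4 : ∀ i, ContDiff ℝ 3 (fun p : Ed d × Ed d => p.2 i - r * b p.1 i) := fun i =>
    ((contDiff_piLp_apply (p := 2) (i := i)).comp contDiff_snd).sub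
      (contDiff_const.mul ((h3 i).comp contDiff_fst))
  refine (h1.comp contDiff_fst).mul (ContDiff.exp (ContDiff.neg ?_))
  refine ContDiff.sum fun i _ => ContDiff.sum fun j _ => contDiff_const.mul ?_
  exact ((h4 i).mul ((h2 i j).comp contDiff_fst)).mul (h4 j)

/-- Gaussian bounds for the kernel and its spatial derivatives up to order three. -/
lemma bound_kern (h : EllipticCoeffs A b a₀ A₀) : ∃ β, 0 < β ∧
    FamBound (fun (p : Icc (0 : ℝ) 1 × Ed d) x => kern A b p.1 x p.2)
      (fun p => Real.exp (-(β * ‖p.2‖ ^ 2))) := by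
  set β : ℝ := 1 / (16 * A₀) with hβ
  have hA₀ := h.pos'
  have hβ0 : 0 < β := by positivity
  refine ⟨β, hβ0, ?_⟩
  simp only [kern_eq]
  obtain ⟨Cb, hCb⟩ := h.normb
  let P := Icc (0 : ℝ) 1 × Ed d
  have hw : ∀ i, FamBound (fun (p : P) x => p.2 i - (p.1 : ℝ) * b x i) (fun p => 1 + ‖p.2‖) := by
    intro i
    have h1 : FamBound (fun (p : P) (_ : Ed d) => p.2 i) (fun p => 1 + ‖p.2‖) :=
      FamBound.const fun p => by
        have := PiLp.norm_apply_le p.2 i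
        rw [Real.norm_eq_abs] at this
        linarith
    have h2 : FamBound (fun (p : P) (_ : Ed d) => -(p.1 : ℝ)) (fun _ => 1) :=
      FamBound.const fun p => by
        rw [abs_neg, abs_of_nonneg p.1.2.1]; exact p.1.2.2
    have h3 := (h2.mul ((h.boundb i).reindex (fun _ : P => ()))).mono
      (B' := fun p : P => 1 + ‖p.2‖) (fun p => by
        have := norm_nonneg p.2
        linarith)
    convert h1.add h3 using 3
    ring
  have hE : FamBound (fun (p : P) x => ∑ i, ∑ j, 1 / 4 * (((p.2 i - (p.1 : ℝ) * b x i) *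
      (A x)⁻¹ i j) * (p.2 j - (p.1 : ℝ) * b x j))) (fun p => (1 + ‖p.2‖) ^ 2) := by
    refine FamBound.sum _ (fun p => by positivity) fun i _ =>
      FamBound.sum _ (fun p => by positivity) fun j _ => ?_
    have h1 := ((hw i).mul ((h.bound_inv i j).reindex (fun _ : P => ()))).mul (hw j)
    have h2 : FamBound (fun (_ : P) (_ : Ed d) => (1 / 4 : ℝ)) (fun _ => 1) :=
      FamBound.const fun p => by norm_num [abs_of_pos]
    exact (h2.mul h1).mono fun p => le_of_eq (by ring)
  have hlow : ∀ (p : P) x, Real.exp (-(∑ i, ∑ j, 1 / 4 * (((p.2 i - (p.1 : ℝ) * b x i) *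
      (A x)⁻¹ i j) * (p.2 j - (p.1 : ℝ) * b x j))))
      ≤ Real.exp (Cb ^ 2 / (4 * A₀)) * Real.exp (-(2 * β * ‖p.2‖ ^ 2)) := by
    intro p x
    rw [← Real.exp_add]
    refine Real.exp_le_exp.mpr ?_
    have e : ∑ i, ∑ j, 1 / 4 * (((p.2 i - (p.1 : ℝ) * b x i) *
      (A x)⁻¹ i j) * (p.2 j - (p.1 : ℝ) * b x j)) = 1 / 4 * quadF (A x)⁻¹ (p.2 - (p.1 : ℝ) • b x) := by
      simp only [quadF, Finset.mul_sum, PiLp.sub_apply, PiLp.smul_apply, smul_eq_mul]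
    rw [e]
    have h1 := le_quadF_inv (h.posDef x) hA₀ (h.upper x) (p.2 - (p.1 : ℝ) • b x)
    have h2 : ‖(p.1 : ℝ) • b x‖ ≤ Cb := by
      rw [norm_smul, Real.norm_eq_abs, abs_of_nonneg p.1.2.1]
      exact (mul_le_of_le_one_left (norm_nonneg _) p.1.2.2).trans (hCb x)
    have h3 : ‖p.2‖ ≤ ‖p.2 - (p.1 : ℝ) • b x‖ + Cb := by
      have := norm_add_le (p.2 - (p.1 : ℝ) • b x) ((p.1 : ℝ) • b x)
      rw [sub_add_cancel] at this
      linarith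
    have h4 : ‖p.2‖ ^ 2 ≤ 2 * ‖p.2 - (p.1 : ℝ) • b x‖ ^ 2 + 2 * Cb ^ 2 := by
      nlinarith [norm_nonneg p.2, sq_nonneg (‖p.2 - (p.1 : ℝ) • b x‖ - Cb)]
    have h5 : A₀⁻¹ * ‖p.2‖ ^ 2 ≤ A₀⁻¹ * (2 * ‖p.2 - (p.1 : ℝ) • b x‖ ^ 2 + 2 * Cb ^ 2) :=
      mul_le_mul_of_nonneg_left h4 (by positivity)
    have e1 : Cb ^ 2 / (4 * A₀) = A₀⁻¹ * Cb ^ 2 / 4 := by field_simp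
    have e2 : 2 * β * ‖p.2‖ ^ 2 = A₀⁻¹ * ‖p.2‖ ^ 2 / 8 := by rw [hβ]; field_simp; ring
    rw [e1, e2]
    linarith
  have hexp := hE.exp_neg (fun p => one_le_pow₀ (by linarith [norm_nonneg p.2]))
    (Real.exp_pos _).le hlow
  obtain ⟨K, hK, hKe⟩ := exists_one_add_pow_le_exp 6 hβ0
  have hfin := (h.bound_prefactor.reindex (fun _ : P => ())).mul hexp
  obtain ⟨g1, K', hK', g2⟩ := hfin
  refine ⟨g1, K' * K, by positivity, fun p k hk x => (g2 p k hk x).trans ?_⟩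
  rw [mul_assoc]
  refine mul_le_mul_of_nonneg_left ?_ hK'
  have := hKe ‖p.2‖ (norm_nonneg _)
  calc 1 * (Real.exp (-(2 * β * ‖p.2‖ ^ 2)) * ((1 + ‖p.2‖) ^ 2) ^ 3)
      = Real.exp (-(2 * β * ‖p.2‖ ^ 2)) * (1 + ‖p.2‖) ^ 6 := by ring
    _ ≤ Real.exp (-(2 * β * ‖p.2‖ ^ 2)) * (K * Real.exp (β * ‖p.2‖ ^ 2)) := by gcongr
    _ = K * (Real.exp (-(2 * β * ‖p.2‖ ^ 2)) * Real.exp (β * ‖p.2‖ ^ 2)) := by ring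
    _ = _ := by rw [← Real.exp_add]; congr 2; ring

end EllipticCoeffs

end KernelBounds

section DirectionalCalculus

variable {d : ℕ}

/-- Third-order Taylor estimate for a curve with an explicit chain of derivatives. -/
lemma norm_taylor_sub_le {v₀ v₁ v₂ v₃ : ℝ → ℂ} (h₀ : ∀ x, HasDerivAt v₀ (v₁ x) x)
    (h₁ : ∀ x, HasDerivAt v₁ (v₂ x) x) (h₂ : ∀ x, HasDerivAt v₂ (v₃ x) x) {r C : ℝ} (hr : 0 ≤ r)
    (hC : ∀ x ∈ Icc 0 r, ‖v₃ x‖ ≤ C) :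
    ‖v₀ r - (v₀ 0 + (r : ℂ) * v₁ 0 + (r : ℂ) ^ 2 / 2 * v₂ 0)‖ ≤ C * r ^ 3 := by
  have hC0 : 0 ≤ C := (norm_nonneg _).trans (hC 0 ⟨le_rfl, hr⟩)
  have hof : ∀ x : ℝ, HasDerivAt (fun y : ℝ => (y : ℂ)) 1 x := fun x => Complex.ofRealCLM.hasDerivAt
  have a2 : ∀ x ∈ Icc 0 r, ‖v₂ x - v₂ 0‖ ≤ C * r := fun x hx =>
    (norm_image_sub_le_of_norm_deriv_le_segment' (fun y _ => (h₂ y).hasDerivWithinAt)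
      (fun y hy => hC y ⟨hy.1, hy.2.le⟩) x hx).trans (by
        have := hx.2
        gcongr
        simpa using this)
  have a1 : ∀ x ∈ Icc 0 r, ‖v₁ x - v₁ 0 - x * v₂ 0‖ ≤ C * r * r := fun x hx => by
    have := (norm_image_sub_le_of_norm_deriv_le_segment' (f := fun y : ℝ => v₁ y - y * v₂ 0)
      (f' := fun y => v₂ y - 1 * v₂ 0)
      (fun y _ => ((h₁ y).sub ((hof y).mul_const _)).hasDerivWithinAt)
      (fun y hy => by simpa using a2 y ⟨hy.1, hy.2.le⟩) x hx).trans (c := C * r * r) (by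
        have := hx.2
        gcongr
        simpa using this)
    simp only [Complex.ofReal_zero, zero_mul, sub_zero] at this
    rwa [sub_right_comm] at this
  have := norm_image_sub_le_of_norm_deriv_le_segment'
      (f := fun y : ℝ => v₀ y - y * v₁ 0 - (y : ℂ) ^ 2 / 2 * v₂ 0)
      (f' := fun y => v₁ y - 1 * v₁ 0 - ((2 : ℕ) * (y : ℂ) ^ (2 - 1) * 1) / 2 * v₂ 0)
      (fun y _ => (((h₀ y).sub ((hof y).mul_const _)).sub
        ((((hof y).pow 2).div_const 2).mul_const _)).hasDerivWithinAt)
      (fun y hy => by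
        have := a1 y ⟨hy.1, hy.2.le⟩
        have e : v₁ y - 1 * v₁ 0 - ((2 : ℕ) * (y : ℂ) ^ (2 - 1) * 1) / 2 * v₂ 0 =
            v₁ y - v₁ 0 - y * v₂ 0 := by
          norm_num
        rw [e]
        exact this) r ⟨hr, le_rfl⟩
  refine le_trans (le_of_eq ?_) (this.trans (le_of_eq (by ring)))
  congr 1
  push_cast
  ring

/-- The partial derivative in the `i`-th coordinate direction. -/
def pd (i : Fin d) (f : Ed d → ℂ) (x : Ed d) : ℂ := fderiv ℝ f x (eb i)

lemma norm_eb (i : Fin d) : ‖(eb i : Ed d)‖ = 1 := by simp [eb]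

lemma sum_smul_eb (w : Ed d) : ∑ i, w i • (eb i : Ed d) = w := by
  ext j
  simp [eb, Finset.sum_apply, Pi.single_apply]

lemma ContDiff.pd {n m : ℕ} {f : Ed d → ℂ} (hf : ContDiff ℝ n f) (hm : m + 1 ≤ n) (i : Fin d) :
    ContDiff ℝ m (pd i f) := by
  have : ((m : ℕ∞) : WithTop ℕ∞) + 1 ≤ (n : ℕ) := by exact_mod_cast hm
  exact (hf.fderiv_right this).clm_apply contDiff_const

lemma norm_iteratedFDeriv_pd_le {k : ℕ} {f : Ed d → ℂ} (hf : ContDiff ℝ (k + 1 : ℕ) f)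
    (i : Fin d) (x : Ed d) :
    ‖iteratedFDeriv ℝ k (pd i f) x‖ ≤ ‖iteratedFDeriv ℝ (k + 1) f x‖ := by
  have h1 : ContDiff ℝ k (fderiv ℝ f) := hf.fderiv_right (by norm_cast)
  have := norm_iteratedFDeriv_clm_apply_const (c := (eb i : Ed d)) h1.contDiffAt (x := x) (N := k) (n := k) le_rfl
  rwa [norm_eb, one_mul, norm_iteratedFDeriv_fderiv] at this

lemma hasDerivAt_comp_smul {f : Ed d → ℂ} (hf : Differentiable ℝ f) (w : Ed d) (x : ℝ) :
    HasDerivAt (fun y : ℝ => f (y • w)) (∑ i, (w i : ℂ) * pd i f (x • w)) x := by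
  have h1 : HasDerivAt (fun y : ℝ => y • w) ((1 : ℝ) • w) x := (hasDerivAt_id x).smul_const w
  have h2 := (hf (x • w)).hasFDerivAt.comp_hasDerivAt x h1
  have e : ∑ i, (w i : ℂ) * pd i f (x • w) = fderiv ℝ f (x • w) ((1 : ℝ) • w) := by
    rw [one_smul]
    conv_rhs => rw [← sum_smul_eb w, map_sum]
    refine Finset.sum_congr rfl fun i _ => ?_
    rw [map_smul, sum_smul_eb]
    simp [pd]
  rw [e]
  exact h2

/-- Jointly smooth families `F h w` whose `h`-derivatives are bounded by Gaussian-type functions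
of `w`. -/
def GaussFam (n : ℕ) (F : Ed d → Ed d → ℂ) : Prop :=
  ContDiff ℝ n (Function.uncurry F) ∧ ∃ K β : ℝ, ∃ m : ℕ, 0 < β ∧ 0 ≤ K ∧
    ∀ k : ℕ, k ≤ n → ∀ h w, ‖iteratedFDeriv ℝ k (fun h => F h w) h‖ ≤
      K * ((1 + ‖w‖) ^ m * Real.exp (-(β * ‖w‖ ^ 2)))

lemma integrable_one_add_pow_mul_exp (m : ℕ) {β : ℝ} (hβ : 0 < β) :
    Integrable (fun w : Ed d => (1 + ‖w‖) ^ m * Real.exp (-(β * ‖w‖ ^ 2))) := by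
  obtain ⟨K, hK, h⟩ := exists_one_add_pow_le_exp m (half_pos hβ)
  have hi : Integrable (fun w : Ed d => Real.exp (-(β / 2) * ‖w‖ ^ 2)) := by
    have := GaussianFourier.integrable_cexp_neg_mul_sq_norm_add (V := Ed d) (b := ((β / 2 : ℝ) : ℂ))
      (by simpa using hβ) 0 0
    convert this.norm using 2 with w
    rw [Complex.norm_exp]
    congr 1
    simp [← Complex.ofReal_pow, ← Complex.ofReal_neg, ← Complex.ofReal_mul, -Complex.ofReal_div]
  refine (hi.const_mul K).mono' (by fun_prop) (ae_of_all _ fun w => ?_)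
  rw [Real.norm_of_nonneg (by positivity)]
  calc _ ≤ K * Real.exp (β / 2 * ‖w‖ ^ 2) * Real.exp (-(β * ‖w‖ ^ 2)) := by
        gcongr; exact h _ (norm_nonneg _)
    _ = K * (Real.exp (β / 2 * ‖w‖ ^ 2) * Real.exp (-(β * ‖w‖ ^ 2))) := by ring
    _ = _ := by rw [← Real.exp_add]; congr 2; ring

namespace GaussFam

variable {n : ℕ} {F : Ed d → Ed d → ℂ}

lemma continuous (hF : GaussFam n F) : Continuous (Function.uncurry F) := hF.1.continuous

lemma contDiff_left (hF : GaussFam n F) (w : Ed d) : ContDiff ℝ n (fun h => F h w) :=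
  hF.1.comp (contDiff_id.prodMk contDiff_const)

lemma integrable_comp (hF : GaussFam n F) {γ : Ed d → Ed d} (hγ : Continuous γ) :
    Integrable (fun w => F (γ w) w) := by
  obtain ⟨-, K, β, m, hβ, hK, hb⟩ := id hF
  refine ((integrable_one_add_pow_mul_exp m hβ).const_mul K).mono'
    (hF.continuous.comp (hγ.prodMk continuous_id)).aestronglyMeasurable (ae_of_all _ fun w => ?_)
  simpa using hb 0 (Nat.zero_le _) (γ w) w

lemma integrable (hF : GaussFam n F) (h : Ed d) : Integrable (fun w => F h w) :=
  hF.integrable_comp continuous_const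

lemma pd {n : ℕ} (hF : GaussFam (n + 1) F) (i : Fin d) :
    GaussFam n (fun h w => pd i (fun h => F h w) h) := by
  obtain ⟨h1, K, β, m, hβ, hK, hb⟩ := id hF
  refine ⟨?_, K, β, m, hβ, hK, fun k hk h w => ?_⟩
  · have h2 : ContDiff ℝ (n + 1 : ℕ) (Function.uncurry fun (x : Ed d × Ed d) (h : Ed d) => F h x.2) :=
      h1.comp (contDiff_snd.prodMk (contDiff_snd.comp contDiff_fst))
    exact (ContDiff.fderiv (n := n) h2 contDiff_fst (by norm_cast)).clm_apply contDiff_const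
  · exact (norm_iteratedFDeriv_pd_le ((hF.contDiff_left w).of_le (by exact_mod_cast by omega))
      i h).trans (hb _ (by omega) h w)

lemma coord_mul (hF : GaussFam n F) (i : Fin d) : GaussFam n (fun h w => (w i : ℂ) * F h w) := by
  obtain ⟨h1, K, β, m, hβ, hK, hb⟩ := id hF
  refine ⟨?_, K, β, m + 1, hβ, hK, fun k hk h w => ?_⟩
  · have : ContDiff ℝ n (fun x : Ed d × Ed d => ((x.2 i : ℝ) : ℂ)) :=
      Complex.ofRealCLM.contDiff.comp ((contDiff_piLp_apply (p := 2) (i := i)).comp contDiff_snd)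
    exact this.mul h1
  · have e : (fun h => (w i : ℂ) * F h w) = (w i : ℂ) • (fun h => F h w) := rfl
    rw [e, iteratedFDeriv_const_smul_apply ((hF.contDiff_left w).of_le (by exact_mod_cast hk)).contDiffAt, norm_smul, Complex.norm_real]
    have h2 : ‖w i‖ ≤ 1 + ‖w‖ := (PiLp.norm_apply_le w i).trans (by linarith)
    calc _ ≤ (1 + ‖w‖) * (K * ((1 + ‖w‖) ^ m * Real.exp (-(β * ‖w‖ ^ 2)))) :=
          mul_le_mul h2 (hb k hk h w) (norm_nonneg _) (by positivity)
      _ = _ := by ring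

/-- Differentiation under the integral sign. -/
lemma pd_integral {n : ℕ} (hF : GaussFam (n + 1) F) (i : Fin d) (h : Ed d) :
    _root_.pd i (fun h => ∫ w, F h w) h = ∫ w, _root_.pd i (fun h => F h w) h := by
  obtain ⟨h1, K, β, m, hβ, hK, hb⟩ := id hF
  have hm : Continuous (Function.uncurry fun h w => fderiv ℝ (fun h => F h w) h) := by
    have h2 : ContDiff ℝ (n + 1 : ℕ) (Function.uncurry fun (x : Ed d × Ed d) (h : Ed d) => F h x.2) :=
      h1.comp (contDiff_snd.prodMk (contDiff_snd.comp contDiff_fst))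
    exact (ContDiff.fderiv (n := n) (m := (n + 1 : ℕ)) h2 contDiff_fst (by norm_cast)).continuous
  have hbd : ∀ h w, ‖fderiv ℝ (fun h => F h w) h‖ ≤
      K * ((1 + ‖w‖) ^ m * Real.exp (-(β * ‖w‖ ^ 2))) := fun h w => by
    have := hb 1 (by omega) h w
    rwa [norm_iteratedFDeriv_one] at this
  have hint := (integrable_one_add_pow_mul_exp (d := d) m hβ).const_mul K
  have hmh : AEStronglyMeasurable (fun w => fderiv ℝ (fun h => F h w) h) volume :=
    (hm.comp (continuous_const.prodMk continuous_id)).aestronglyMeasurable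
  have key := hasFDerivAt_integral_of_dominated_of_fderiv_le (μ := volume) (F := F)
    (F' := fun h w => fderiv ℝ (fun h => F h w) h) (x₀ := h) (s := univ) univ_mem
    (Eventually.of_forall fun h => (hF.integrable h).aestronglyMeasurable) (hF.integrable h)
    hmh (ae_of_all _ fun w x _ => hbd x w) hint
    (ae_of_all _ fun w x _ => ((hF.contDiff_left w).differentiable (by norm_cast) x).hasFDerivAt)
  unfold _root_.pd
  rw [key.fderiv, ContinuousLinearMap.integral_apply (hint.mono' hmh (ae_of_all _ (hbd h)))]

end GaussFam

end DirectionalCalculus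

section TestFunctionBounds

variable {d : ℕ}

/-- An integrable weight on `ℝ^d` with polynomial decay. -/
def wt (q : Ed d) : ℝ := ((1 + ‖q‖) ^ (d + 1))⁻¹

lemma wt_pos (q : Ed d) : 0 < wt q := by unfold wt; positivity

lemma wt_le_one (q : Ed d) : wt q ≤ 1 :=
  inv_le_one_of_one_le₀ (one_le_pow₀ (by linarith [norm_nonneg q]))

lemma wt_sub_le (q h : Ed d) : wt (q - h) ≤ wt q * (1 + ‖h‖) ^ (d + 1) := by
  unfold wt
  rw [inv_mul_eq_div, inv_le_comm₀ (by positivity) (by positivity), inv_div, div_le_iff₀ (by positivity),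
    ← mul_pow]
  have : ‖q‖ ≤ ‖q - h‖ + ‖h‖ := by simpa using norm_add_le (q - h) h
  gcongr
  nlinarith [norm_nonneg h, norm_nonneg (q - h)]

lemma integrable_wt : Integrable (wt : Ed d → ℝ) := by
  have := integrable_one_add_norm (E := Ed d) (μ := volume) (r := (d + 1 : ℕ)) (by simp)
  convert this using 2 with q
  rw [Real.rpow_neg (by positivity), Real.rpow_natCast]
  rfl

/-- `φ` is of class `C³` and its derivatives up to order three are bounded by `K * wt`. -/
def TestBound (φ : Ed d → ℂ) (K : ℝ) : Prop :=
  ContDiff ℝ (3 : ℕ) φ ∧ 0 ≤ K ∧ ∀ k : ℕ, k ≤ 3 → ∀ y, ‖iteratedFDeriv ℝ k φ y‖ ≤ K * wt y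

lemma exists_testBound {φ : Ed d → ℂ} (h : ContDiff ℝ (3 : ℕ) φ) (hs : HasCompactSupport φ) :
    ∃ K, TestBound φ K := by
  have : ∀ k : ℕ, ∃ K, 0 ≤ K ∧ (k ≤ 3 → ∀ y, ‖iteratedFDeriv ℝ k φ y‖ ≤ K * wt y) := by
    intro k
    by_cases hk : k ≤ 3
    · have hc : Continuous (fun y : Ed d => (1 + ‖y‖) ^ (d + 1) • iteratedFDeriv ℝ k φ y) :=
        (by fun_prop : Continuous (fun y : Ed d => (1 + ‖y‖) ^ (d + 1))).smul
          (h.continuous_iteratedFDeriv (by exact_mod_cast hk))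
      obtain ⟨K, hK⟩ := (hs.iteratedFDeriv k).smul_left
        (f := fun y : Ed d => (1 + ‖y‖) ^ (d + 1)) |>.exists_bound_of_continuous hc
      refine ⟨K, (norm_nonneg _).trans (hK 0), fun _ y => ?_⟩
      have := hK y
      rw [Pi.smul_apply', norm_smul, Real.norm_of_nonneg (by positivity)] at this
      rw [wt, ← div_eq_mul_inv, le_div_iff₀ (by positivity), mul_comm]
      exact this
    · exact ⟨0, le_rfl, fun hk' => absurd hk' hk⟩
  choose K hK0 hK using this
  refine ⟨∑ k ∈ Finset.range 4, K k, h, Finset.sum_nonneg fun k _ => hK0 k, fun k hk y => ?_⟩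
  refine (hK k hk y).trans (mul_le_mul_of_nonneg_right ?_ (wt_pos y).le)
  exact Finset.single_le_sum (fun k _ => hK0 k) (Finset.mem_range.mpr (by omega))

/-- The function `h ↦ f (q - s h) φ (q - h)`. -/
def shiftMul (f : Ed d → ℝ) (φ : Ed d → ℂ) (s : ℝ) (q h : Ed d) : ℂ :=
  (f (q - s • h) : ℂ) * φ (q - h)

lemma norm_iteratedFDeriv_comp_sub_smul_le {V : Type*} [NormedAddCommGroup V] [NormedSpace ℝ V]
    {f : Ed d → V} (hf : ContDiff ℝ (3 : ℕ) f) {s : ℝ} (hs : s ∈ Icc (0 : ℝ) 1) (q h : Ed d) {k : ℕ}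
    (hk : k ≤ 3) :
    ‖iteratedFDeriv ℝ k (fun h => f (q - s • h)) h‖ ≤ ‖iteratedFDeriv ℝ k f (q - s • h)‖ := by
  let L : Ed d →L[ℝ] Ed d := (-s) • ContinuousLinearMap.id ℝ (Ed d)
  have e : (fun h => f (q - s • h)) = (fun x => f (q + x)) ∘ L := by
    funext x
    simp [L, sub_eq_add_neg]
  have hf' : ContDiff ℝ (3 : ℕ) (fun x => f (q + x)) := hf.comp (contDiff_const.add contDiff_id)
  have hL : ‖L‖ ≤ 1 := by
    refine ContinuousLinearMap.opNorm_le_bound _ zero_le_one fun x => ?_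
    simp only [L, smul_apply, ContinuousLinearMap.id_apply, norm_smul, norm_neg,
      Real.norm_of_nonneg hs.1]
    exact mul_le_mul_of_nonneg_right hs.2 (norm_nonneg _)
  rw [e, L.iteratedFDeriv_comp_right hf' h (i := k) (by exact_mod_cast hk),
    iteratedFDeriv_comp_add_left]
  refine (ContinuousMultilinearMap.norm_compContinuousLinearMap_le _ _).trans ?_
  have : q + L h = q - s • h := by simp [L, sub_eq_add_neg]
  rw [this]
  exact mul_le_of_le_one_right (norm_nonneg _)
    (Finset.prod_le_one (fun _ _ => norm_nonneg _) fun _ _ => hL)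

lemma contDiff_shiftMul {f : Ed d → ℝ} {φ : Ed d → ℂ} {n : ℕ} (hf : ContDiff ℝ n f)
    (hφ : ContDiff ℝ n φ) (s : ℝ) (q : Ed d) : ContDiff ℝ n (shiftMul f φ s q) :=
  (Complex.ofRealCLM.contDiff.comp (hf.comp (by fun_prop))).mul (hφ.comp (by fun_prop))

lemma norm_iteratedFDeriv_shiftMul_le {f : Ed d → ℝ} {φ : Ed d → ℂ} {C K : ℝ}
    (hf : ContDiff ℝ (3 : ℕ) f) (hφ : TestBound φ K)
    (hC : ∀ k : ℕ, k ≤ 3 → ∀ x, ‖iteratedFDeriv ℝ k f x‖ ≤ C) {s : ℝ} (hs : s ∈ Icc (0 : ℝ) 1)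
    (q h : Ed d) {k : ℕ} (hk : k ≤ 3) :
    ‖iteratedFDeriv ℝ k (shiftMul f φ s q) h‖ ≤ 8 * C * (K * wt (q - h)) := by
  have hf' : ContDiff ℝ (3 : ℕ) (fun h => f (q - s • h)) := hf.comp (by fun_prop)
  have hφ' : ContDiff ℝ (3 : ℕ) (fun h => φ (q - h)) := hφ.1.comp (by fun_prop)
  have e : shiftMul f φ s q = fun h => f (q - s • h) • φ (q - h) := by
    funext h
    rw [Complex.real_smul]
    rfl
  rw [e]
  refine (norm_iteratedFDeriv_smul_le hf' hφ' h (n := k) (by exact_mod_cast hk)).trans ?_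
  have h1 : ∀ i, i ≤ 3 → ‖iteratedFDeriv ℝ i (fun h => φ (q - h)) h‖ ≤ K * wt (q - h) := fun i hi => by
    have := norm_iteratedFDeriv_comp_sub_smul_le hφ.1 (s := 1) ⟨zero_le_one, le_rfl⟩ q h hi
    simp only [one_smul] at this
    exact this.trans (hφ.2.2 i hi _)
  have := sum_choose_mul_le hk
    (u := fun i => ‖iteratedFDeriv ℝ i (fun h => f (q - s • h)) h‖)
    (v := fun i => ‖iteratedFDeriv ℝ i (fun h => φ (q - h)) h‖)
    (fun i hi => (norm_iteratedFDeriv_comp_sub_smul_le hf hs q h hi).trans (hC i hi _)) h1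
  exact (this (fun _ => norm_nonneg _) fun _ => norm_nonneg _).trans (le_of_eq (by ring))

end TestFunctionBounds

section ShortTimeExpansion

variable {d : ℕ} {A : Ed d → Matrix (Fin d) (Fin d) ℝ} {b : Ed d → Ed d} {a₀ A₀ : ℝ}
  {φ : Ed d → ℂ} {K : ℝ}

/-- The integrand of the rescaled operator, with the base point displaced by `h`. -/
def kernFam (A : Ed d → Matrix (Fin d) (Fin d) ℝ) (b : Ed d → Ed d) (φ : Ed d → ℂ) (s r : ℝ)
    (q h w : Ed d) : ℂ :=
  (kern A b r (q - s • h) w : ℂ) * φ (q - h)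

namespace EllipticCoeffs

lemma bound_kernFam (H : EllipticCoeffs A b a₀ A₀) (hφ : TestBound φ K) : ∃ C β, 0 < β ∧ 0 ≤ C ∧
    ∀ s ∈ Icc (0 : ℝ) 1, ∀ r ∈ Icc (0 : ℝ) 1, ∀ q, ∀ k : ℕ, k ≤ 3 → ∀ h w,
      ‖iteratedFDeriv ℝ k (fun h => kernFam A b φ s r q h w) h‖ ≤
        C * Real.exp (-(β * ‖w‖ ^ 2)) * wt (q - h) := by
  obtain ⟨β, hβ, h1, C, hC, h2⟩ := H.bound_kern
  refine ⟨8 * C * K, β, hβ, by have := hφ.2.1; positivity, fun s hs r hr q k hk h w => ?_⟩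
  have := norm_iteratedFDeriv_shiftMul_le (f := fun x => kern A b r x w)
    (h1 (⟨r, hr⟩, w)) hφ (fun k hk x => h2 (⟨r, hr⟩, w) k hk x) hs q h hk
  exact this.trans (le_of_eq (by ring))

lemma gaussFam_kernFam (H : EllipticCoeffs A b a₀ A₀) (hφ : TestBound φ K) {s r : ℝ}
    (hs : s ∈ Icc (0 : ℝ) 1) (hr : r ∈ Icc (0 : ℝ) 1) (q : Ed d) :
    GaussFam 3 (kernFam A b φ s r q) := by
  obtain ⟨C, β, hβ, hC, hb⟩ := H.bound_kernFam hφ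
  refine ⟨?_, C, β, 0, hβ, hC, fun k hk h w => (hb s hs r hr q k hk h w).trans ?_⟩
  · have h1 : ContDiff ℝ (3 : ℕ) (fun p : Ed d × Ed d => kern A b r (q - s • p.1) p.2) :=
      (H.contDiff_kern r).comp (f := fun p : Ed d × Ed d => (q - s • p.1, p.2)) (by fun_prop)
    exact (Complex.ofRealCLM.contDiff.comp h1).mul (hφ.1.comp (by fun_prop))
  · rw [pow_zero, one_mul]
    exact mul_le_of_le_one_right (by positivity) (wt_le_one _)

lemma integral_kernFam_mul (f : Ed d → ℝ) (s r : ℝ) (q h : Ed d) :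
    ∫ w, (f w : ℂ) * kernFam A b φ s r q h w =
      ((∫ w, f w * kern A b r (q - s • h) w : ℝ) : ℂ) * φ (q - h) := by
  rw [← integral_complex_ofReal, ← integral_mul_const]
  refine integral_congr_ae (ae_of_all _ fun w => ?_)
  simp only [kernFam]
  push_cast
  ring

lemma integral_kernFam (H : EllipticCoeffs A b a₀ A₀) (s r : ℝ) (q h : Ed d) :
    ∫ w, kernFam A b φ s r q h w = φ (q - h) := by
  have := integral_kernFam_mul (A := A) (b := b) (φ := φ) (fun _ => 1) s r q h
  simp only [Complex.ofReal_one, one_mul] at this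
  rw [this]
  unfold kern
  rw [(gaussDens_moments (H.posDef _) _).1]
  simp

lemma integral_coord_mul_kernFam (H : EllipticCoeffs A b a₀ A₀) (s r : ℝ) (q h : Ed d)
    (i : Fin d) :
    ∫ w, (w i : ℂ) * kernFam A b φ s r q h w =
      r * shiftMul (fun x => b x i) φ s q h := by
  rw [integral_kernFam_mul (fun w => w i)]
  unfold kern
  rw [(gaussDens_moments (H.posDef _) _).2.1 i]
  simp [shiftMul, mul_assoc]

lemma integral_coord_mul_coord_mul_kernFam (H : EllipticCoeffs A b a₀ A₀) (s r : ℝ) (q h : Ed d)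
    (i j : Fin d) :
    ∫ w, (w i : ℂ) * ((w j : ℂ) * kernFam A b φ s r q h w) =
      2 * shiftMul (fun x => A x i j) φ s q h +
        (r : ℂ) ^ 2 * shiftMul (fun x => b x i * b x j) φ s q h := by
  have := integral_kernFam_mul (A := A) (b := b) (φ := φ) (fun w => w i * w j) s r q h
  simp only [Complex.ofReal_mul, mul_assoc] at this
  rw [this]
  unfold kern
  simp only [← mul_assoc]
  rw [(gaussDens_moments (H.posDef _) _).2.2 i j]
  simp [shiftMul]
  ring

end EllipticCoeffs

end ShortTimeExpansion

section Expansion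

variable {d : ℕ} {A : Ed d → Matrix (Fin d) (Fin d) ℝ} {b : Ed d → Ed d} {a₀ A₀ : ℝ}
  {φ : Ed d → ℂ} {K : ℝ}

lemma pd_const_mul {f : Ed d → ℂ} (hf : Differentiable ℝ f) (c : ℂ) (i : Fin d) :
    pd i (fun h => c * f h) = fun h => c * pd i f h := by
  funext h
  unfold pd
  rw [fderiv_const_mul (hf h)]
  simp

lemma pd_add {f g : Ed d → ℂ} (hf : Differentiable ℝ f) (hg : Differentiable ℝ g) (i : Fin d) :
    pd i (fun h => f h + g h) = fun h => pd i f h + pd i g h := by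
  funext h
  unfold pd
  rw [fderiv_fun_add (hf h) (hg h)]
  simp

lemma norm_pd_le {f : Ed d → ℂ} (hf : ContDiff ℝ (1 : ℕ) f) (i : Fin d) (x : Ed d) :
    ‖pd i f x‖ ≤ ‖iteratedFDeriv ℝ 1 f x‖ := by
  simpa using norm_iteratedFDeriv_pd_le (k := 0) hf i x

lemma norm_pd_pd_le {f : Ed d → ℂ} (hf : ContDiff ℝ (2 : ℕ) f) (i j : Fin d) (x : Ed d) :
    ‖pd j (pd i f) x‖ ≤ ‖iteratedFDeriv ℝ 2 f x‖ :=
  (norm_pd_le (hf.pd (m := 1) le_rfl i) j x).trans (norm_iteratedFDeriv_pd_le hf i x)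

lemma norm_pd_pd_pd_le {f : Ed d → ℂ} (hf : ContDiff ℝ (3 : ℕ) f) (i j k : Fin d) (x : Ed d) :
    ‖pd k (pd j (pd i f)) x‖ ≤ ‖iteratedFDeriv ℝ 3 f x‖ :=
  (norm_pd_pd_le (hf.pd (m := 2) le_rfl i) j k x).trans (norm_iteratedFDeriv_pd_le hf i x)

lemma hasDerivAt_sum_pd {ι : Type*} [Fintype ι] {f : ι → Ed d → ℂ} (hf : ∀ i, Differentiable ℝ (f i))
    (c : ι → ℂ) (w : Ed d) (x : ℝ) :
    HasDerivAt (fun y : ℝ => ∑ i, c i * f i (y • w))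
      (∑ i, c i * ∑ j, (w j : ℂ) * pd j (f i) (x • w)) x :=
  HasDerivAt.fun_sum fun i _ => (hasDerivAt_comp_smul (hf i) w x).const_mul (c i)

/-- Third-order Taylor estimate along a segment issuing from the origin, in coordinates. -/
lemma norm_taylor_segment_sub_le {f : Ed d → ℂ} (hf : ContDiff ℝ (3 : ℕ) f) {C r : ℝ} (hr : 0 ≤ r)
    (w : Ed d) (hC : ∀ x ∈ Icc (0 : ℝ) r, ‖iteratedFDeriv ℝ 3 f (x • w)‖ ≤ C) :
    ‖f (r • w) - (f 0 + (r : ℂ) * ∑ i, (w i : ℂ) * pd i f 0 +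
        (r : ℂ) ^ 2 / 2 * ∑ i, (w i : ℂ) * ∑ j, (w j : ℂ) * pd j (pd i f) 0)‖ ≤
      d ^ 3 * ‖w‖ ^ 3 * C * r ^ 3 := by
  have d0 : Differentiable ℝ f := hf.differentiable (by norm_num)
  have c1 : ∀ i, ContDiff ℝ (2 : ℕ) (pd i f) := fun i => hf.pd le_rfl i
  have d1 : ∀ i, Differentiable ℝ (pd i f) := fun i => (c1 i).differentiable (by norm_num)
  have d2 : ∀ i j, Differentiable ℝ (pd j (pd i f)) := fun i j =>
    ((c1 i).pd (m := 1) le_rfl j).differentiable (by norm_num)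
  have key := norm_taylor_sub_le (v₀ := fun y => f (y • w))
    (v₁ := fun y => ∑ i, (w i : ℂ) * pd i f (y • w))
    (v₂ := fun y => ∑ i, (w i : ℂ) * ∑ j, (w j : ℂ) * pd j (pd i f) (y • w))
    (v₃ := fun y => ∑ i, (w i : ℂ) * ∑ j, (w j : ℂ) * ∑ k, (w k : ℂ) *
      pd k (pd j (pd i f)) (y • w)) (C := d ^ 3 * ‖w‖ ^ 3 * C)
    (hasDerivAt_comp_smul d0 w) (hasDerivAt_sum_pd d1 _ w)
    (fun x => HasDerivAt.fun_sum fun i _ => (hasDerivAt_sum_pd (d2 i) _ w x).const_mul _) hr ?_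
  · simpa using key
  · intro x hx
    have hw : ∀ i, ‖(w i : ℂ)‖ ≤ ‖w‖ := fun i => by
      rw [Complex.norm_real]; exact PiLp.norm_apply_le w i
    have hsum : ∀ {g : Fin d → ℂ} {B : ℝ}, (∀ i, ‖g i‖ ≤ B) →
        ‖∑ i, (w i : ℂ) * g i‖ ≤ d * (‖w‖ * B) := fun {g B} hg => by
      have := norm_sum_le_of_le Finset.univ (f := fun i => (w i : ℂ) * g i) (n := fun _ => ‖w‖ * B)
        fun i _ => (norm_mul _ _).trans_le
          (mul_le_mul (hw i) (hg i) (norm_nonneg _) (norm_nonneg _))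
      simpa using this
    refine (hsum fun i => hsum fun j => hsum fun k =>
      (norm_pd_pd_pd_le hf i j k _).trans (hC x hx)).trans (le_of_eq (by ring))

namespace GaussFam

lemma integral_pd_pd {n : ℕ} {F : Ed d → Ed d → ℂ} (hF : GaussFam (n + 2) F) (i j : Fin d)
    (h : Ed d) :
    ∫ w, _root_.pd j (_root_.pd i (fun h => F h w)) h =
      _root_.pd j (_root_.pd i (fun h => ∫ w, F h w)) h := by
  have e : _root_.pd i (fun h => ∫ w, F h w) = fun h => ∫ w, _root_.pd i (fun h => F h w) h := by
    funext h
    exact hF.pd_integral (n := n + 1) i h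
  rw [e]
  exact ((GaussFam.pd (n := n + 1) hF i).pd_integral j h).symm

end GaussFam

/-- The limiting generator applied to `φ`, as a sum of derivatives of shifted products. -/
def shiftGen (A : Ed d → Matrix (Fin d) (Fin d) ℝ) (b : Ed d → Ed d) (φ : Ed d → ℂ) (s : ℝ)
    (q : Ed d) : ℂ :=
  ∑ i, pd i (shiftMul (fun x => b x i) φ s q) 0 +
    ∑ i, ∑ j, pd j (pd i (shiftMul (fun x => A x i j) φ s q)) 0

namespace EllipticCoeffs

lemma exists_norm_pd_shiftMul_le {f : Ed d → ℝ} (hf : FamBound (fun (_ : Unit) => f) (fun _ => 1))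
    (hφ : TestBound φ K) : ∃ C, 0 ≤ C ∧ ∀ s ∈ Icc (0 : ℝ) 1, ∀ q, ∀ i j : Fin d,
      ‖pd i (shiftMul f φ s q) 0‖ ≤ C * wt q ∧ ‖pd j (pd i (shiftMul f φ s q)) 0‖ ≤ C * wt q := by
  obtain ⟨h1, C, hC, h2⟩ := hf
  have h1' : ContDiff ℝ (3 : ℕ) f := h1 ()
  refine ⟨8 * C * K, by have := hφ.2.1; positivity, fun s hs q i j => ?_⟩
  have hc : ContDiff ℝ (3 : ℕ) (shiftMul f φ s q) := contDiff_shiftMul h1' hφ.1 s q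
  have hb : ∀ k : ℕ, k ≤ 3 → ‖iteratedFDeriv ℝ k (shiftMul f φ s q) 0‖ ≤ 8 * C * K * wt q :=
    fun k hk => by
      have := norm_iteratedFDeriv_shiftMul_le h1' hφ (C := C)
        (fun k hk x => by simpa using h2 () k hk x) hs q 0 hk
      rw [sub_zero] at this
      exact this.trans (le_of_eq (by ring))
  exact ⟨(norm_pd_le (hc.of_le (by norm_num)) i 0).trans (hb 1 (by norm_num)),
    (norm_pd_pd_le (hc.of_le (by norm_num)) i j 0).trans (hb 2 (by norm_num))⟩

lemma boundbb (H : EllipticCoeffs A b a₀ A₀) (i j : Fin d) :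
    FamBound (fun (_ : Unit) q => b q i * b q j) (fun _ => 1) := by
  simpa using (H.boundb i).mul (H.boundb j)

lemma exists_norm_shiftGen_le (H : EllipticCoeffs A b a₀ A₀) (hφ : TestBound φ K) :
    ∃ C, 0 ≤ C ∧ ∀ s ∈ Icc (0 : ℝ) 1, ∀ q, ‖shiftGen A b φ s q‖ ≤ C * wt q := by
  choose C₁ hC₁ h₁ using fun i => exists_norm_pd_shiftMul_le (H.boundb i) hφ
  choose C₂ hC₂ h₂ using fun i j => exists_norm_pd_shiftMul_le (H.boundA i j) hφ
  refine ⟨∑ i, C₁ i + ∑ i, ∑ j, C₂ i j, add_nonneg (Finset.sum_nonneg fun i _ => hC₁ i)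
    (Finset.sum_nonneg fun i _ => Finset.sum_nonneg fun j _ => hC₂ i j), fun s hs q => ?_⟩
  rw [add_mul, Finset.sum_mul, Finset.sum_mul]
  refine (norm_add_le _ _).trans (add_le_add (norm_sum_le_of_le _ fun i _ => (h₁ i s hs q i i).1)
    (norm_sum_le_of_le _ fun i _ => ?_))
  rw [Finset.sum_mul]
  exact norm_sum_le_of_le _ fun j _ => (h₂ i j s hs q i j).2

lemma integral_first_order (H : EllipticCoeffs A b a₀ A₀) (hφ : TestBound φ K) {s r : ℝ}
    (hs : s ∈ Icc (0 : ℝ) 1) (hr : r ∈ Icc (0 : ℝ) 1) (q : Ed d) (i : Fin d) :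
    Integrable (fun w => (w i : ℂ) * pd i (fun h => kernFam A b φ s r q h w) 0) ∧
      ∫ w, (w i : ℂ) * pd i (fun h => kernFam A b φ s r q h w) 0 =
        r * pd i (shiftMul (fun x => b x i) φ s q) 0 := by
  have hM := H.gaussFam_kernFam hφ hs hr q
  have hd : ∀ w, Differentiable ℝ (fun h => kernFam A b φ s r q h w) := fun w =>
    (hM.contDiff_left w).differentiable (by norm_num)
  refine ⟨((GaussFam.pd (n := 2) hM i).coord_mul i).integrable 0, ?_⟩
  have h1 := (hM.coord_mul i).pd_integral (n := 2) i 0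
  simp only [pd_const_mul (hd _), H.integral_coord_mul_kernFam] at h1
  rw [← h1, pd_const_mul]
  exact (contDiff_shiftMul (n := 3) ((H.boundb i).1 ()) hφ.1 s q).differentiable (by norm_num)

lemma integral_second_order (H : EllipticCoeffs A b a₀ A₀) (hφ : TestBound φ K) {s r : ℝ}
    (hs : s ∈ Icc (0 : ℝ) 1) (hr : r ∈ Icc (0 : ℝ) 1) (q : Ed d) (i j : Fin d) :
    Integrable (fun w => (w i : ℂ) * ((w j : ℂ) *
        pd j (pd i (fun h => kernFam A b φ s r q h w)) 0)) ∧
      ∫ w, (w i : ℂ) * ((w j : ℂ) * pd j (pd i (fun h => kernFam A b φ s r q h w)) 0) =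
        2 * pd j (pd i (shiftMul (fun x => A x i j) φ s q)) 0 +
          (r : ℂ) ^ 2 * pd j (pd i (shiftMul (fun x => b x i * b x j) φ s q)) 0 := by
  have hM := H.gaussFam_kernFam hφ hs hr q
  have hc : ∀ w, ContDiff ℝ (3 : ℕ) (fun h => kernFam A b φ s r q h w) := hM.contDiff_left
  have hd : ∀ w, Differentiable ℝ (fun h => kernFam A b φ s r q h w) := fun w =>
    (hc w).differentiable (by norm_num)
  have hd1 : ∀ w, Differentiable ℝ (pd i (fun h => kernFam A b φ s r q h w)) := fun w =>
    ((hc w).pd (m := 2) le_rfl i).differentiable (by norm_num)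
  refine ⟨(((GaussFam.pd (n := 1) (GaussFam.pd (n := 2) hM i) j).coord_mul j).coord_mul i).integrable
    0, ?_⟩
  have h1 := ((hM.coord_mul j).coord_mul i).integral_pd_pd (n := 1) i j 0
  have cA : ContDiff ℝ (3 : ℕ) (shiftMul (fun x => A x i j) φ s q) :=
    contDiff_shiftMul ((H.boundA i j).1 ()) hφ.1 s q
  have cb : ContDiff ℝ (3 : ℕ) (shiftMul (fun x => b x i * b x j) φ s q) :=
    contDiff_shiftMul ((H.boundbb i j).1 ()) hφ.1 s q
  have dA : Differentiable ℝ (shiftMul (fun x => A x i j) φ s q) := cA.differentiable (by norm_num)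
  have db : Differentiable ℝ (shiftMul (fun x => b x i * b x j) φ s q) :=
    cb.differentiable (by norm_num)
  have dA' : Differentiable ℝ (pd i (shiftMul (fun x => A x i j) φ s q)) :=
    (cA.pd (m := 2) le_rfl i).differentiable (by norm_num)
  have db' : Differentiable ℝ (pd i (shiftMul (fun x => b x i * b x j) φ s q)) :=
    (cb.pd (m := 2) le_rfl i).differentiable (by norm_num)
  simp only [H.integral_coord_mul_coord_mul_kernFam] at h1
  rw [pd_add (dA.const_mul _) (db.const_mul _), pd_const_mul dA, pd_const_mul db,
    pd_add (dA'.const_mul _) (db'.const_mul _), pd_const_mul dA', pd_const_mul db'] at h1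
  refine Eq.trans ?_ h1
  refine integral_congr_ae (ae_of_all _ fun w => ?_)
  simp only
  rw [pd_const_mul ((hd w).const_mul _), pd_const_mul (hd w),
    pd_const_mul ((hd1 w).const_mul _), pd_const_mul (hd1 w)]

/-- The first-order short-time expansion of the rescaled operator without potential. -/
theorem norm_integral_kernFam_sub_le (H : EllipticCoeffs A b a₀ A₀) (hφ : TestBound φ K) :
    ∃ C, 0 ≤ C ∧ ∀ s ∈ Icc (0 : ℝ) 1, ∀ r ∈ Icc (0 : ℝ) 1, ∀ q,
      ‖(∫ w, kernFam A b φ s r q (r • w) w) - (φ q + (r : ℂ) ^ 2 * shiftGen A b φ s q)‖ ≤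
        C * r ^ 3 * wt q := by
  obtain ⟨C, β, hβ, hC, hb⟩ := H.bound_kernFam hφ
  choose D hD hDb using fun i j => exists_norm_pd_shiftMul_le (H.boundbb i j) hφ
  set I : ℝ := ∫ w : Ed d, (1 + ‖w‖) ^ (d + 4) * Real.exp (-(β * ‖w‖ ^ 2)) with hI
  have hI0 : 0 ≤ I := integral_nonneg fun w => by positivity
  set S : ℝ := ∑ i, ∑ j, D i j with hS
  have hS0 : 0 ≤ S := Finset.sum_nonneg fun i _ => Finset.sum_nonneg fun j _ => hD i j
  refine ⟨d ^ 3 * C * I + S, by positivity, fun s hs r hr q => ?_⟩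
  have hr0 := hr.1
  have hM := H.gaussFam_kernFam hφ hs hr q
  set M := kernFam A b φ s r q with hMdef
  set B : ℂ := ∑ i, ∑ j, pd j (pd i (shiftMul (fun x => b x i * b x j) φ s q)) 0 with hB
  have hBn : ‖B‖ ≤ S * wt q := by
    rw [hS, Finset.sum_mul]
    refine norm_sum_le_of_le _ fun i _ => ?_
    rw [Finset.sum_mul]
    exact norm_sum_le_of_le _ fun j _ => (hDb i j s hs q i j).2
  have i0 : Integrable (fun w => M 0 w) := hM.integrable 0
  have i1 : Integrable (fun w : Ed d => (r : ℂ) * ∑ i, (w i : ℂ) * pd i (fun h => M h w) 0) :=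
    (integrable_finsetSum _ fun i _ => (H.integral_first_order hφ hs hr q i).1).const_mul _
  have esum : (fun w : Ed d => (r : ℂ) ^ 2 / 2 * ∑ i, (w i : ℂ) * ∑ j, (w j : ℂ) *
      pd j (pd i (fun h => M h w)) 0) = fun w : Ed d => (r : ℂ) ^ 2 / 2 * ∑ i, ∑ j,
        (w i : ℂ) * ((w j : ℂ) * pd j (pd i (fun h => M h w)) 0) := by
    funext w
    congr 1
    exact Finset.sum_congr rfl fun i _ => Finset.mul_sum _ _ _
  have i2 : Integrable (fun w : Ed d => (r : ℂ) ^ 2 / 2 * ∑ i, (w i : ℂ) * ∑ j, (w j : ℂ) *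
      pd j (pd i (fun h => M h w)) 0) := by
    rw [esum]
    exact (integrable_finsetSum _ fun i _ => integrable_finsetSum _ fun j _ =>
      (H.integral_second_order hφ hs hr q i j).1).const_mul _
  have e1 : ∫ w : Ed d, (r : ℂ) * ∑ i, (w i : ℂ) * pd i (fun h => M h w) 0 =
      (r : ℂ) ^ 2 * ∑ i, pd i (shiftMul (fun x => b x i) φ s q) 0 := by
    rw [integral_const_mul, integral_finsetSum _ fun i _ =>
      (H.integral_first_order hφ hs hr q i).1]
    simp only [(H.integral_first_order hφ hs hr q _).2]
    rw [← Finset.mul_sum]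
    ring
  have e2 : ∫ w : Ed d, (r : ℂ) ^ 2 / 2 * ∑ i, (w i : ℂ) * ∑ j, (w j : ℂ) *
      pd j (pd i (fun h => M h w)) 0 =
      (r : ℂ) ^ 2 * ∑ i, ∑ j, pd j (pd i (shiftMul (fun x => A x i j) φ s q)) 0 +
        (r : ℂ) ^ 4 / 2 * B := by
    rw [esum]
    rw [integral_const_mul, integral_finsetSum _ fun i _ => integrable_finsetSum _ fun j _ =>
      (H.integral_second_order hφ hs hr q i j).1]
    have : ∀ i, ∫ w, ∑ j, (w i : ℂ) * ((w j : ℂ) * pd j (pd i (fun h => M h w)) 0) =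
        ∑ j, (2 * pd j (pd i (shiftMul (fun x => A x i j) φ s q)) 0 +
          (r : ℂ) ^ 2 * pd j (pd i (shiftMul (fun x => b x i * b x j) φ s q)) 0) := fun i => by
      rw [integral_finsetSum _ fun j _ => (H.integral_second_order hφ hs hr q i j).1]
      exact Finset.sum_congr rfl fun j _ => (H.integral_second_order hφ hs hr q i j).2
    rw [Finset.sum_congr rfl fun i _ => this i]
    simp only [Finset.sum_add_distrib, ← Finset.mul_sum]
    rw [hB]
    ring
  have e0 : ∫ w, M 0 w = φ q := by rw [hMdef, H.integral_kernFam, sub_zero]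
  have iv : Integrable (fun w => M (r • w) w) := hM.integrable_comp (continuous_const_smul r)
  have hrem : ‖∫ w, (M (r • w) w - (M 0 w + (r : ℂ) * ∑ i, (w i : ℂ) * pd i (fun h => M h w) 0 +
      (r : ℂ) ^ 2 / 2 * ∑ i, (w i : ℂ) * ∑ j, (w j : ℂ) * pd j (pd i (fun h => M h w)) 0))‖ ≤
      ∫ w : Ed d, d ^ 3 * C * wt q * r ^ 3 * ((1 + ‖w‖) ^ (d + 4) * Real.exp (-(β * ‖w‖ ^ 2))) := by
    refine norm_integral_le_of_norm_le ((integrable_one_add_pow_mul_exp _ hβ).const_mul _)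
      (ae_of_all _ fun w => ?_)
    have := norm_taylor_segment_sub_le (hM.contDiff_left w) hr0 w
      (C := C * Real.exp (-(β * ‖w‖ ^ 2)) * (wt q * (1 + ‖w‖) ^ (d + 1))) fun x hx => by
        refine (hb s hs r hr q 3 le_rfl _ w).trans ?_
        gcongr
        refine (wt_sub_le _ _).trans (mul_le_mul_of_nonneg_left ?_ (wt_pos q).le)
        gcongr
        rw [norm_smul, Real.norm_of_nonneg hx.1]
        exact mul_le_of_le_one_left (norm_nonneg _) (hx.2.trans hr.2)
    refine this.trans ?_
    have h3 : ‖w‖ ^ 3 ≤ (1 + ‖w‖) ^ 3 := by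
      have := norm_nonneg w
      gcongr
      linarith
    calc _ = d ^ 3 * C * wt q * r ^ 3 * (‖w‖ ^ 3 * (1 + ‖w‖) ^ (d + 1) *
          Real.exp (-(β * ‖w‖ ^ 2))) := by ring
      _ ≤ d ^ 3 * C * wt q * r ^ 3 * ((1 + ‖w‖) ^ 3 * (1 + ‖w‖) ^ (d + 1) *
          Real.exp (-(β * ‖w‖ ^ 2))) := by
            have := wt_pos q
            gcongr
      _ = _ := by rw [← pow_add, show 3 + (d + 1) = d + 4 by ring]
  have i01 : Integrable (fun w : Ed d => M 0 w + (r : ℂ) * ∑ i, (w i : ℂ) *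
      pd i (fun h => M h w) 0) := i0.add i1
  have i012 : Integrable (fun w : Ed d => M 0 w + (r : ℂ) * ∑ i, (w i : ℂ) *
      pd i (fun h => M h w) 0 + (r : ℂ) ^ 2 / 2 * ∑ i, (w i : ℂ) * ∑ j, (w j : ℂ) *
        pd j (pd i (fun h => M h w)) 0) := i01.add i2
  rw [integral_sub iv i012, integral_add i01 i2, integral_add i0 i1, e0, e1, e2,
    integral_const_mul, ← hI] at hrem
  have h4 : ‖(r : ℂ) ^ 4 / 2 * B‖ ≤ r ^ 3 * (S * wt q) := by
    rw [norm_mul]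
    refine mul_le_mul ?_ hBn (norm_nonneg _) (by positivity)
    rw [norm_div, norm_pow, Complex.norm_real, Real.norm_of_nonneg hr0, Complex.norm_two]
    have : r ^ 4 ≤ r ^ 3 := pow_le_pow_of_le_one hr0 hr.2 (by norm_num)
    have : 0 ≤ r ^ 3 := by positivity
    linarith
  have e : (∫ w, M (r • w) w) - (φ q + (r : ℂ) ^ 2 * shiftGen A b φ s q) =
      ((∫ w, M (r • w) w) - (φ q + (r : ℂ) ^ 2 * ∑ i, pd i (shiftMul (fun x => b x i) φ s q) 0 +
      ((r : ℂ) ^ 2 * ∑ i, ∑ j, pd j (pd i (shiftMul (fun x => A x i j) φ s q)) 0 +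
        (r : ℂ) ^ 4 / 2 * B))) + (r : ℂ) ^ 4 / 2 * B := by
    unfold shiftGen
    ring
  rw [e]
  exact (norm_add_le _ _).trans ((add_le_add hrem h4).trans (le_of_eq (by ring)))

end EllipticCoeffs

end Expansion

section Generator

variable {d : ℕ} {A : Ed d → Matrix (Fin d) (Fin d) ℝ} {b : Ed d → Ed d} {a₀ A₀ : ℝ}
  {φ : Ed d → ℂ} {K : ℝ}

lemma pd_shiftMul {f : Ed d → ℝ} (hf : Differentiable ℝ f) (hφ : Differentiable ℝ φ) (s : ℝ)
    (q : Ed d) (i : Fin d) :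
    pd i (shiftMul f φ s q) = fun h => (-s : ℂ) * shiftMul (fun x => fderiv ℝ f x (eb i)) φ s q h +
      (-1 : ℂ) * shiftMul f (pd i φ) s q h := by
  funext h
  have h1 : HasFDerivAt (fun h : Ed d => q - s • h) (-(s • ContinuousLinearMap.id ℝ (Ed d))) h :=
    ((hasFDerivAt_id h).const_smul s).const_sub q
  have h2 : HasFDerivAt (fun h : Ed d => q - h) (-(ContinuousLinearMap.id ℝ (Ed d))) h :=
    (hasFDerivAt_id h).const_sub q
  have h3 := Complex.ofRealCLM.hasFDerivAt.comp h ((hf (q - s • h)).hasFDerivAt.comp h h1)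
  have h4 := (hφ (q - h)).hasFDerivAt.comp h h2
  have h5 := h3.mul h4
  change fderiv ℝ (shiftMul f φ s q) h (eb i) = _
  have h6 : fderiv ℝ (shiftMul f φ s q) h = _ := h5.fderiv
  rw [h6]
  simp [shiftMul, pd]
  ring

lemma shiftMul_zero (f : Ed d → ℝ) (φ : Ed d → ℂ) (s : ℝ) (q : Ed d) :
    shiftMul f φ s q 0 = f q * φ q := by
  simp [shiftMul]

lemma EllipticCoeffs.shiftGen_eq (H : EllipticCoeffs A b a₀ A₀) (hφ : ContDiff ℝ (3 : ℕ) φ)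
    (c : Ed d → ℝ) (τ : ℝ) (q : Ed d) :
    shiftGen A b φ (1 - τ) q = c q * φ q - Ltau A b c τ φ q := by
  have dφ : Differentiable ℝ φ := hφ.differentiable (by norm_num)
  have dφ' : ∀ i, Differentiable ℝ (pd i φ) := fun i =>
    (hφ.pd (m := 2) le_rfl i).differentiable (by norm_num)
  have cA : ∀ i j, ContDiff ℝ 3 (fun x => A x i j) := fun i j => (H.boundA i j).1 ()
  have db : ∀ i, Differentiable ℝ (fun x => b x i) := fun i =>
    ((H.boundb i).1 ()).differentiable (by norm_num)
  have dA : ∀ i j, Differentiable ℝ (fun x => A x i j) := fun i j =>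
    (cA i j).differentiable (by norm_num)
  have cA' : ∀ i j k, ContDiff ℝ 2 (fun x => fderiv ℝ (fun x => A x i j) x (eb k)) := fun i j k =>
    ((cA i j).fderiv_right (m := 2) (by norm_num)).clm_apply contDiff_const
  have dA' : ∀ i j k, Differentiable ℝ (fun x => fderiv ℝ (fun x => A x i j) x (eb k)) :=
    fun i j k => (cA' i j k).differentiable (by norm_num)
  have dsm : ∀ {f : Ed d → ℝ} {ψ : Ed d → ℂ}, Differentiable ℝ f → Differentiable ℝ ψ →
      Differentiable ℝ (shiftMul f ψ (1 - τ) q) := fun hf hψ =>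
    (Complex.ofRealCLM.differentiable.comp (hf.comp (by fun_prop))).mul (hψ.comp (by fun_prop))
  have e1 : ∀ i, pd i (shiftMul (fun x => b x i) φ (1 - τ) q) 0 =
      (-(1 - τ : ℝ) : ℂ) * (fderiv ℝ (fun x => b x i) q (eb i) * φ q) +
        (-1 : ℂ) * (b q i * fderiv ℝ φ q (eb i)) := fun i => by
    rw [pd_shiftMul (db i) dφ]
    simp only [shiftMul_zero, pd]
  have e2 : ∀ i j, pd j (pd i (shiftMul (fun x => A x i j) φ (1 - τ) q)) 0 =
      ((1 - τ : ℝ) : ℂ) ^ 2 * (fderiv ℝ (fun x => fderiv ℝ (fun x => A x i j) x (eb i)) q (eb j) *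
        φ q) + (1 - τ : ℝ) * (fderiv ℝ (fun x => A x i j) q (eb i) * fderiv ℝ φ q (eb j)) +
      (1 - τ : ℝ) * (fderiv ℝ (fun x => A x i j) q (eb j) * fderiv ℝ φ q (eb i)) +
      A q i j * fderiv ℝ (fun x => fderiv ℝ φ x (eb i)) q (eb j) := fun i j => by
    rw [pd_shiftMul (dA i j) dφ, pd_add ((dsm (dA' i j i) dφ).const_mul _)
      ((dsm (dA i j) (dφ' i)).const_mul _), pd_const_mul (dsm (dA' i j i) dφ),
      pd_const_mul (dsm (dA i j) (dφ' i)), pd_shiftMul (dA' i j i) dφ, pd_shiftMul (dA i j) (dφ' i)]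
    simp only [shiftMul_zero]
    have : ∀ x, pd i φ x = fderiv ℝ φ x (eb i) := fun _ => rfl
    have h2 : pd j (pd i φ) q = fderiv ℝ (fun x => fderiv ℝ φ x (eb i)) q (eb j) := rfl
    have h3 : pd j φ q = fderiv ℝ φ q (eb j) := rfl
    rw [this, h2, h3]
    ring
  have hsymm : ∀ i j, (fun x => A x i j) = fun x => A x j i := fun i j => by
    funext x
    exact (H.symm x).apply j i
  have s1 : ∑ i, ∑ j, (A q i j : ℂ) * fderiv ℝ (fun x => fderiv ℝ φ x (eb i)) q (eb j) =
      ∑ i, ∑ j, (A q i j : ℂ) * fderiv ℝ (fun x => fderiv ℝ φ x (eb j)) q (eb i) := by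
    rw [Finset.sum_comm]
    refine Finset.sum_congr rfl fun i _ => Finset.sum_congr rfl fun j _ => ?_
    rw [(H.symm q).apply]
  have s2 : ∑ i, ∑ j, (fderiv ℝ (fun x => A x i j) q (eb i) : ℂ) * fderiv ℝ φ q (eb j) =
      ∑ i, ∑ j, (fderiv ℝ (fun x => A x i j) q (eb j) : ℂ) * fderiv ℝ φ q (eb i) := by
    rw [Finset.sum_comm]
    refine Finset.sum_congr rfl fun i _ => Finset.sum_congr rfl fun j _ => ?_
    rw [hsymm]
  have s3 : ∑ i, ∑ j, (fderiv ℝ (fun x => fderiv ℝ (fun x => A x i j) x (eb i)) q (eb j) : ℂ) =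
      ∑ i, ∑ j, (fderiv ℝ (fun x => fderiv ℝ (fun x => A x i j) x (eb j)) q (eb i) : ℂ) := by
    rw [Finset.sum_comm]
    refine Finset.sum_congr rfl fun i _ => Finset.sum_congr rfl fun j _ => ?_
    rw [hsymm]
  unfold shiftGen Ltau
  simp only [e1, e2, Finset.sum_add_distrib, ← Finset.mul_sum, s1, s2]
  simp only [← Finset.sum_mul, s3]
  push_cast
  simp only [sub_mul, Finset.sum_sub_distrib, mul_assoc, ← Finset.mul_sum]
  ring

end Generator

section KernelRescaling

variable {d : ℕ} {A : Ed d → Matrix (Fin d) (Fin d) ℝ} {b : Ed d → Ed d}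

lemma quadF_smul (M : Matrix (Fin d) (Fin d) ℝ) (r : ℝ) (v : Ed d) :
    quadF M (r • v) = r ^ 2 * quadF M v := by
  simp only [quadF, Finset.mul_sum, PiLp.smul_apply, smul_eq_mul]
  exact Finset.sum_congr rfl fun i _ => Finset.sum_congr rfl fun j _ => by ring

lemma gker_sq_smul (c : Ed d → ℝ) {r : ℝ} (hr : 0 < r) (x w : Ed d) :
    r ^ d * gker A b c (r ^ 2) x (r • w) = Real.exp (-(r ^ 2 * c x)) * kern A b r x w := by
  have e1 : r ^ d * (4 * Real.pi * r ^ 2) ^ (-(d : ℝ) / 2) = (gaussMass d)⁻¹ := by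
    have h0 : 0 < √(4 * Real.pi) := Real.sqrt_pos.mpr (by positivity)
    have h1 : 4 * Real.pi * r ^ 2 = (√(4 * Real.pi) * r) ^ (2 : ℝ) := by
      rw [Real.rpow_two, mul_pow, Real.sq_sqrt (by positivity)]
    rw [h1, ← Real.rpow_mul (by positivity), show (2 : ℝ) * (-(d : ℝ) / 2) = -d by ring,
      Real.rpow_neg (by positivity), Real.rpow_natCast, mul_pow, gaussMass]
    field_simp
  have e2 : r • w - r ^ 2 • b x = r • (w - r • b x) := by
    rw [smul_sub, smul_smul, sq]
  unfold gker kern gaussDens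
  rw [e2, quadF_smul, ← e1]
  have e3 : -(r ^ 2 * quadF (A x)⁻¹ (w - r • b x)) / (4 * r ^ 2) =
      -(quadF (A x)⁻¹ (w - r • b x)) / 4 := by
    field_simp
  rw [e3]
  ring

lemma Fop_sq_eq (c : Ed d → ℝ) (φ : Ed d → ℂ) (τ : ℝ) {r : ℝ} (hr : 0 < r) (q : Ed d) :
    Fop A b c τ φ (r ^ 2) q = ∫ w, (Real.exp (-(r ^ 2 * c (q - (1 - τ) • r • w))) : ℂ) *
      kernFam A b φ (1 - τ) r q (r • w) w := by
  unfold Fop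
  rw [if_neg (by positivity)]
  set G : Ed d → ℂ := fun q₁ => ((gker A b c (r ^ 2) (τ • q + (1 - τ) • q₁) (q - q₁) : ℝ) : ℂ) * φ q₁
    with hG
  have h1 : ∫ q₁, G q₁ = (r : ℂ) ^ d * ∫ w, G (q - r • w) := by
    rw [Measure.integral_comp_smul volume (fun y => G (q - y)), integral_sub_left_eq_self G volume q]
    rw [finrank_euclideanSpace_fin, abs_of_pos (by positivity), Complex.real_smul]
    push_cast
    rw [← mul_assoc, mul_inv_cancel₀ (by exact_mod_cast (pow_pos hr d).ne'), one_mul]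
  rw [h1, ← integral_const_mul]
  refine integral_congr_ae (ae_of_all _ fun w => ?_)
  have e1 : τ • q + (1 - τ) • (q - r • w) = q - (1 - τ) • r • w := by
    rw [smul_sub, sub_smul, one_smul]
    abel
  simp only [hG, kernFam]
  rw [e1, sub_sub_cancel, ← mul_assoc, ← mul_assoc]
  congr 1
  exact_mod_cast gker_sq_smul c hr (q - (1 - τ) • r • w) w

end KernelRescaling

section ShortTimeError

variable {d : ℕ} {A : Ed d → Matrix (Fin d) (Fin d) ℝ} {b : Ed d → Ed d} {a₀ A₀ : ℝ}
  {φ : Ed d → ℂ} {K : ℝ}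

lemma abs_exp_neg_sub_le {x y δ : ℝ} (hx : |x| ≤ 1) (h : |x - y| ≤ δ) :
    |Real.exp (-x) - (1 - y)| ≤ x ^ 2 + δ := by
  have h1 := Real.abs_exp_sub_one_sub_id_le (x := -x) (by rwa [abs_neg])
  have h2 : Real.exp (-x) - (1 - y) = (Real.exp (-x) - 1 - -x) + -(x - y) := by ring
  rw [h2]
  refine (abs_add_le _ _).trans (add_le_add (by simpa using h1) (by rwa [abs_neg]))

namespace EllipticCoeffs

/-- The zeroth-order coefficient acts to leading order as multiplication by `1 - r² c(q)`. -/
lemma norm_Fop_sq_sub_le (H : EllipticCoeffs A b a₀ A₀) (hφ : TestBound φ K) {c : Ed d → ℝ}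
    (hc : Continuous c) {Cc : ℝ} (hCc : ∀ x, |c x| ≤ Cc)
    (hLip : ∀ x y, |c x - c y| ≤ Cc * ‖x - y‖) {τ : ℝ} (hτ : τ ∈ Icc (0 : ℝ) 1) :
    ∃ C, 0 ≤ C ∧ ∀ r ∈ Ioc (0 : ℝ) 1, r ^ 2 * Cc ≤ 1 → ∀ q,
      ‖Fop A b c τ φ (r ^ 2) q -
        (1 - (r : ℂ) ^ 2 * c q) * ∫ w, kernFam A b φ (1 - τ) r q (r • w) w‖ ≤ C * r ^ 3 * wt q := by
  obtain ⟨C, β, hβ, hC, hb⟩ := H.bound_kernFam hφ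
  have hCc0 : 0 ≤ Cc := (abs_nonneg _).trans (hCc 0)
  have hs : 1 - τ ∈ Icc (0 : ℝ) 1 := ⟨by linarith [hτ.2], by linarith [hτ.1]⟩
  set I : ℝ := ∫ w : Ed d, (1 + ‖w‖) ^ (d + 2) * Real.exp (-(β * ‖w‖ ^ 2)) with hI
  have hI0 : 0 ≤ I := integral_nonneg fun w => by positivity
  refine ⟨(Cc ^ 2 + Cc) * C * I, by positivity, fun r hr hrc q => ?_⟩
  have hr0 := hr.1
  have hr' : r ∈ Icc (0 : ℝ) 1 := ⟨hr.1.le, hr.2⟩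
  have hM := H.gaussFam_kernFam hφ hs hr' q
  set M := kernFam A b φ (1 - τ) r q with hMdef
  have iv : Integrable (fun w => M (r • w) w) := hM.integrable_comp (continuous_const_smul r)
  have cE : Continuous fun w : Ed d => (Real.exp (-(r ^ 2 * c (q - (1 - τ) • r • w))) : ℂ) := by
    fun_prop
  have iE : Integrable (fun w => (Real.exp (-(r ^ 2 * c (q - (1 - τ) • r • w))) : ℂ) *
      M (r • w) w) := by
    refine iv.bdd_mul (c := Real.exp 1) cE.aestronglyMeasurable (ae_of_all _ fun w => ?_)
    rw [Complex.norm_real, Real.norm_of_nonneg (Real.exp_pos _).le]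
    refine Real.exp_le_exp.mpr ?_
    have h1 := neg_le_of_abs_le (hCc (q - (1 - τ) • r • w))
    nlinarith [sq_nonneg r]
  rw [Fop_sq_eq c φ τ hr0 q, ← integral_const_mul, ← integral_sub iE (iv.const_mul _)]
  have key : ∀ w, ‖(Real.exp (-(r ^ 2 * c (q - (1 - τ) • r • w))) : ℂ) * M (r • w) w -
      (1 - (r : ℂ) ^ 2 * c q) * M (r • w) w‖ ≤
        (Cc ^ 2 + Cc) * C * r ^ 3 * wt q * ((1 + ‖w‖) ^ (d + 2) * Real.exp (-(β * ‖w‖ ^ 2))) := by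
    intro w
    have hw := norm_nonneg w
    set x := q - (1 - τ) • r • w with hx
    have hxq : ‖x - q‖ ≤ r * ‖w‖ := by
      rw [hx, sub_sub_cancel_left, norm_neg, norm_smul, norm_smul, Real.norm_of_nonneg hs.1,
        Real.norm_of_nonneg hr0.le]
      exact mul_le_of_le_one_left (by positivity) hs.2
    have h1 : |r ^ 2 * c x| ≤ r ^ 2 * Cc := by
      rw [abs_mul, abs_of_nonneg (sq_nonneg r)]
      exact mul_le_mul_of_nonneg_left (hCc x) (sq_nonneg r)
    have h2 : |r ^ 2 * c x - r ^ 2 * c q| ≤ r ^ 3 * Cc * ‖w‖ := by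
      rw [← mul_sub, abs_mul, abs_of_nonneg (sq_nonneg r)]
      calc r ^ 2 * |c x - c q| ≤ r ^ 2 * (Cc * (r * ‖w‖)) := by
            gcongr
            exact (hLip x q).trans (mul_le_mul_of_nonneg_left hxq hCc0)
        _ = _ := by ring
    have h3 := abs_exp_neg_sub_le (h1.trans hrc) h2
    have h4 : (r ^ 2 * c x) ^ 2 ≤ r ^ 3 * Cc ^ 2 := by
      have h5 : (r ^ 2 * c x) ^ 2 ≤ (r ^ 2 * Cc) ^ 2 := sq_le_sq' (abs_le.mp h1).1 (abs_le.mp h1).2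
      have h6 : r ^ 4 ≤ r ^ 3 := pow_le_pow_of_le_one hr0.le hr.2 (by norm_num)
      nlinarith [sq_nonneg Cc]
    have h7 : |Real.exp (-(r ^ 2 * c x)) - (1 - r ^ 2 * c q)| ≤
        (Cc ^ 2 + Cc) * r ^ 3 * (1 + ‖w‖) := by
      have p1 : 0 ≤ r ^ 3 * Cc := by positivity
      have p2 : 0 ≤ r ^ 3 * Cc ^ 2 * ‖w‖ := by positivity
      nlinarith
    have h8 : ‖M (r • w) w‖ ≤ C * Real.exp (-(β * ‖w‖ ^ 2)) * (wt q * (1 + ‖w‖) ^ (d + 1)) := by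
      have := hb _ hs r hr' q 0 (by norm_num) (r • w) w
      rw [norm_iteratedFDeriv_zero] at this
      refine this.trans ?_
      gcongr
      refine (wt_sub_le _ _).trans (mul_le_mul_of_nonneg_left ?_ (wt_pos q).le)
      gcongr
      rw [norm_smul, Real.norm_of_nonneg hr0.le]
      exact mul_le_of_le_one_left hw hr.2
    have e : (Real.exp (-(r ^ 2 * c x)) : ℂ) - (1 - (r : ℂ) ^ 2 * c q) =
        ((Real.exp (-(r ^ 2 * c x)) - (1 - r ^ 2 * c q) : ℝ) : ℂ) := by push_cast; ring
    rw [← sub_mul, e, norm_mul, Complex.norm_real, Real.norm_eq_abs]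
    refine (mul_le_mul h7 h8 (norm_nonneg _) (by positivity)).trans (le_of_eq ?_)
    ring
  refine (norm_integral_le_of_norm_le ((integrable_one_add_pow_mul_exp _ hβ).const_mul _)
    (ae_of_all _ key)).trans (le_of_eq ?_)
  rw [integral_const_mul, ← hI]
  ring

/-- The pointwise error of the first-order approximation, with an integrable weight. -/
theorem norm_Fop_div_add_Ltau_le (H : EllipticCoeffs A b a₀ A₀) (hφ : TestBound φ K)
    {c : Ed d → ℝ} (hc : Continuous c) {Cc : ℝ} (hCc : ∀ x, |c x| ≤ Cc)
    (hLip : ∀ x y, |c x - c y| ≤ Cc * ‖x - y‖) {τ : ℝ} (hτ : τ ∈ Icc (0 : ℝ) 1) :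
    ∃ C, 0 ≤ C ∧ ∀ r ∈ Ioc (0 : ℝ) 1, r ^ 2 * Cc ≤ 1 → ∀ q,
      ‖(Fop A b c τ φ (r ^ 2) q - φ q) / ((r ^ 2 : ℝ) : ℂ) + Ltau A b c τ φ q‖ ≤ C * r * wt q := by
  have hs : 1 - τ ∈ Icc (0 : ℝ) 1 := ⟨by linarith [hτ.2], by linarith [hτ.1]⟩
  have hCc0 : 0 ≤ Cc := (abs_nonneg _).trans (hCc 0)
  obtain ⟨C₁, hC₁, h₁⟩ := H.norm_Fop_sq_sub_le hφ hc hCc hLip hτ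
  obtain ⟨C₂, hC₂, h₂⟩ := H.norm_integral_kernFam_sub_le hφ
  obtain ⟨C₃, hC₃, h₃⟩ := H.exists_norm_shiftGen_le hφ
  refine ⟨C₁ + 2 * C₂ + Cc * C₃, by positivity, fun r hr hrc q => ?_⟩
  have hr0 := hr.1
  have hw := wt_pos q
  have a1 := h₁ r hr hrc q
  have a2 := h₂ _ hs r ⟨hr0.le, hr.2⟩ q
  have a3 := h₃ _ hs q
  have hT := H.shiftGen_eq hφ.1 c τ q
  set I := ∫ w, kernFam A b φ (1 - τ) r q (r • w) w
  set T := shiftGen A b φ (1 - τ) q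
  set F := Fop A b c τ φ (r ^ 2) q
  have hL : Ltau A b c τ φ q = c q * φ q - T := by rw [hT]; ring
  have hrC : (r : ℂ) ≠ 0 := by exact_mod_cast hr0.ne'
  have e : (F - φ q) / ((r ^ 2 : ℝ) : ℂ) + Ltau A b c τ φ q =
      ((F - (1 - (r : ℂ) ^ 2 * c q) * I) + (1 - (r : ℂ) ^ 2 * c q) * (I - (φ q + (r : ℂ) ^ 2 * T)) -
        (r : ℂ) ^ 4 * (c q * T)) / (r : ℂ) ^ 2 := by
    rw [hL]
    push_cast
    field_simp
    ring
  have b0 : ‖(1 - (r : ℂ) ^ 2 * c q)‖ ≤ 2 := by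
    refine (norm_sub_le _ _).trans ?_
    rw [norm_one, norm_mul, norm_pow, Complex.norm_real, Complex.norm_real, Real.norm_of_nonneg hr0.le,
      Real.norm_eq_abs]
    have := mul_le_mul_of_nonneg_left (hCc q) (sq_nonneg r)
    linarith
  have b1 : ‖(1 - (r : ℂ) ^ 2 * c q) * (I - (φ q + (r : ℂ) ^ 2 * T))‖ ≤ 2 * (C₂ * r ^ 3 * wt q) := by
    rw [norm_mul]
    exact mul_le_mul b0 a2 (norm_nonneg _) (by norm_num)
  have b2 : ‖(r : ℂ) ^ 4 * (c q * T)‖ ≤ r ^ 3 * (Cc * (C₃ * wt q)) := by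
    rw [norm_mul, norm_mul, norm_pow, Complex.norm_real, Complex.norm_real,
      Real.norm_of_nonneg hr0.le, Real.norm_eq_abs]
    have := pow_le_pow_of_le_one hr0.le hr.2 (show 3 ≤ 4 by norm_num)
    exact mul_le_mul this (mul_le_mul (hCc q) a3 (norm_nonneg _) hCc0) (by positivity)
      (by positivity)
  rw [e, norm_div, norm_pow, Complex.norm_real, Real.norm_of_nonneg hr0.le, div_le_iff₀ (by positivity)]
  refine (norm_sub_le _ _).trans ((add_le_add ((norm_add_le _ _).trans (add_le_add a1 b1)) b2).trans
    (le_of_eq ?_))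
  ring

end EllipticCoeffs

lemma famBound_of_iteratedFDeriv_bounded {f : Ed d → ℝ} (hf : ContDiff ℝ 4 f)
    (h : ∀ n : ℕ, n ≤ 4 → ∃ C : ℝ, ∀ q, ‖iteratedFDeriv ℝ n f q‖ ≤ C) :
    FamBound (fun (_ : Unit) => f) (fun _ => 1) := by
  have : ∀ n : ℕ, ∃ C : ℝ, 0 ≤ C ∧ (n ≤ 4 → ∀ q, ‖iteratedFDeriv ℝ n f q‖ ≤ C) := fun n => by
    by_cases hn : n ≤ 4
    · obtain ⟨C, hC⟩ := h n hn
      exact ⟨C, (norm_nonneg _).trans (hC 0), fun _ => hC⟩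
    · exact ⟨0, le_rfl, fun hn' => absurd hn' hn⟩
  choose C hC0 hC using this
  refine ⟨fun _ => hf.of_le (by norm_num), ∑ n ∈ Finset.range 4, C n,
    Finset.sum_nonneg fun n _ => hC0 n, fun _ k hk x => ?_⟩
  rw [mul_one]
  exact (hC k (by omega) x).trans
    (Finset.single_le_sum (fun n _ => hC0 n) (Finset.mem_range.mpr (by omega)))

end ShortTimeError

/-- On test functions, the strong `L¹`-derivative at `t = 0` of the family `F_τ(t)` equals
`−L^τ`: `lim_{t→0+} ‖(F_τ(t)φ − φ)/t + L^τφ‖_{L¹} = 0`. -/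
theorem statement9 {d : ℕ} (hd : 1 ≤ d) (τ : ℝ) (hτ : τ ∈ Set.Icc (0 : ℝ) 1)
    (A : Ed d → Matrix (Fin d) (Fin d) ℝ) (hAsymm : ∀ q, (A q).IsSymm)
    (b : Ed d → Ed d) (c : Ed d → ℝ)
    (hA4 : ∀ i j, ContDiff ℝ 4 (fun q : Ed d => A q i j))
    (hA4b : ∀ i j, ∀ n : ℕ, n ≤ 4 →
      ∃ C : ℝ, ∀ q : Ed d, ‖iteratedFDeriv ℝ n (fun q : Ed d => A q i j) q‖ ≤ C)
    (hb4 : ContDiff ℝ 4 b)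
    (hb4b : ∀ n : ℕ, n ≤ 4 → ∃ C : ℝ, ∀ q : Ed d, ‖iteratedFDeriv ℝ n b q‖ ≤ C)
    (hc4 : ContDiff ℝ 4 c)
    (hc4b : ∀ n : ℕ, n ≤ 4 → ∃ C : ℝ, ∀ q : Ed d, ‖iteratedFDeriv ℝ n c q‖ ≤ C)
    (a₀ A₀ : ℝ) (ha₀ : 0 < a₀) (ha₀A₀ : a₀ ≤ A₀)
    (hell : ∀ q p : Ed d, a₀ * ‖p‖ ^ 2 ≤ quadF (A q) p ∧ quadF (A q) p ≤ A₀ * ‖p‖ ^ 2)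
    (φ : Ed d → ℂ) (hφsmooth : ContDiff ℝ (⊤ : ℕ∞) φ) (hφsupp : HasCompactSupport φ) :
    Tendsto (fun t : ℝ =>
        ∫ q : Ed d, ‖(Fop A b c τ φ t q - φ q) / (t : ℂ) + Ltau A b c τ φ q‖)
      (𝓝[>] 0) (𝓝 0) := by
  have hcb : ∀ q, |c q| ≤ max (hc4b 0 (by norm_num)).choose (hc4b 1 (by norm_num)).choose := fun q => by
    have := (hc4b 0 (by norm_num)).choose_spec q
    rw [norm_iteratedFDeriv_zero, Real.norm_eq_abs] at this
    exact this.trans (le_max_left _ _)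
  have hcL : ∀ x y, |c x - c y| ≤
      max (hc4b 0 (by norm_num)).choose (hc4b 1 (by norm_num)).choose * ‖x - y‖ := fun x y => by
    rw [← Real.norm_eq_abs]
    refine Convex.norm_image_sub_le_of_norm_fderiv_le (𝕜 := ℝ) (s := Set.univ)
      (fun z _ => hc4.differentiable (by norm_num) z) (fun z _ => ?_) convex_univ
      (Set.mem_univ y) (Set.mem_univ x)
    rw [← norm_iteratedFDeriv_one]
    exact ((hc4b 1 (by norm_num)).choose_spec z).trans (le_max_right _ _)
  set Cc := max (hc4b 0 (by norm_num)).choose (hc4b 1 (by norm_num)).choose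
  have H : EllipticCoeffs A b a₀ A₀ :=
    { symm := hAsymm
      pos := ha₀
      pos' := ha₀.trans_le ha₀A₀
      lower := fun q p => (hell q p).1
      upper := fun q p => (hell q p).2
      boundA := fun i j =>
        famBound_of_iteratedFDeriv_bounded (hA4 i j) (hA4b i j)
      boundb := fun i => by
        set P : Ed d →L[ℝ] ℝ := EuclideanSpace.proj i
        refine famBound_of_iteratedFDeriv_bounded
          (P.contDiff.comp hb4) fun n hn => ?_
        obtain ⟨C, hC⟩ := hb4b n hn
        refine ⟨‖P‖ * C, fun q => ?_⟩
        exact (P.norm_iteratedFDeriv_comp_left hb4.contDiffAt (by exact_mod_cast hn)).trans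
          (mul_le_mul_of_nonneg_left (hC q) (norm_nonneg _))
      normb := by
        obtain ⟨C, hC⟩ := hb4b 0 (by norm_num)
        exact ⟨C, fun q => by simpa only [norm_iteratedFDeriv_zero] using hC q⟩ }
  obtain ⟨K, hφ⟩ := exists_testBound
    (contDiff_infty.mp hφsmooth 3) hφsupp
  obtain ⟨C, hC, h⟩ := H.norm_Fop_div_add_Ltau_le hφ hc4.continuous hcb hcL hτ
  have hlim : Tendsto (fun t : ℝ => C * √t * ∫ q : Ed d, wt q) (𝓝[>] 0) (𝓝 0) := by
    have : Continuous fun t : ℝ => C * √t * ∫ q : Ed d, wt q := by fun_prop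
    simpa using (this.tendsto 0).mono_left nhdsWithin_le_nhds
  have hsmall : ∀ᶠ t : ℝ in 𝓝[>] 0, t * Cc ≤ 1 := by
    have : Continuous fun t : ℝ => t * Cc := by fun_prop
    refine (this.tendsto 0).mono_left nhdsWithin_le_nhds |>.eventually_le_const ?_
    simp
  refine squeeze_zero' (.of_forall fun t => integral_nonneg fun q => norm_nonneg _) ?_ hlim
  filter_upwards [hsmall, Ioc_mem_nhdsGT (zero_lt_one' ℝ)] with t ht ht1
  have hs : √t ^ 2 = t := Real.sq_sqrt ht1.1.le
  have hr : √t ∈ Ioc (0 : ℝ) 1 := ⟨Real.sqrt_pos.mpr ht1.1, Real.sqrt_le_one.mpr ht1.2⟩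
  rw [← integral_const_mul]
  refine integral_mono_of_nonneg (.of_forall fun q => norm_nonneg _)
    (integrable_wt.const_mul _) (.of_forall fun q => ?_)
  have := h √t hr (by rwa [hs]) q
  rwa [hs] at this
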